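/- Let d = 2 and 1 < p < ∞. Identify ℤ_ℂ = ℤ + iℤ with ℤ², and define the probabilistic discrete Beurling–Ahlfors transform 𝓑 f(n) = Σ_{m ∈ ℤ²} [ (𝒦^{(22)}(n−m) − 𝒦^{(11)}(n−m)) + 2i 𝒦^{(21)}(n−m) ] f(m) for f : ℤ² → ℂ. Then ‖𝓑 f‖_{ℓ^p(ℤ²;ℂ)} ≤ 2(p* − 1) ‖f‖_{ℓ^p(ℤ²;ℂ)} for every f ∈ ℓ^p(ℤ²;ℂ), and ‖𝓑 f‖_{ℓ^p} ≤ √2 (p* − 1) ‖f‖_{ℓ^p} for every real-valued f ∈ ℓ^p(ℤ²;ℝ). -/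

import Mathlib

open MeasureTheory Real Filter

noncomputable section

/-- The lattice ℤ^d. -/
abbrev ZLat (d : ℕ) := Fin d → ℤ

/-- Embedding of the lattice ℤ^d into Euclidean space ℝ^d. -/
def latVec {d : ℕ} (m : ZLat d) : EuclideanSpace ℝ (Fin d) := WithLp.toLp 2 (fun i => (m i : ℝ))

/-- The (Gaussian) heat kernel on ℝ^d. -/
def heatK (d : ℕ) (t : ℝ) (x : EuclideanSpace ℝ (Fin d)) : ℝ :=
  (2 * π * t) ^ (-(d : ℝ) / 2) * Real.exp (-‖x‖ ^ 2 / (2 * t))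

/-- The periodic heat kernel H_t(x) = Σ_{n ∈ ℤ^d} P_t(x − n). -/
def pHeatK (d : ℕ) (t : ℝ) (x : EuclideanSpace ℝ (Fin d)) : ℝ :=
  ∑' n : ZLat d, heatK d t (x - latVec n)

/-- Partial derivative in the j-th coordinate direction. -/
def pderiv {d : ℕ} (j : Fin d) (f : EuclideanSpace ℝ (Fin d) → ℝ)
    (x : EuclideanSpace ℝ (Fin d)) : ℝ :=
  fderiv ℝ f x (EuclideanSpace.single j 1)

/-- The constant c_d = π^{-d/2} Γ((d+2)/2). -/
def cConst (d : ℕ) : ℝ := π ^ (-(d : ℝ) / 2) * Real.Gamma (((d : ℝ) + 2) / 2)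

/-- The discrete second-order Riesz kernel K_dis^{(jk)}. -/
def discK (d : ℕ) (j k : Fin d) (m : ZLat d) : ℝ :=
  if m = 0 then 0 else cConst d * (m j : ℝ) * (m k : ℝ) / ‖latVec m‖ ^ (d + 2)

/-- The discrete second-order Riesz transform R_dis^{(jk)}. -/
def Rdis (d : ℕ) (j k : Fin d) (f : ZLat d → ℝ) (n : ZLat d) : ℝ :=
  ∑' m : ZLat d, discK d j k m * f (n - m)

/-- The probabilistic kernel 𝒦^{(jk)}(m). -/
def probK (d : ℕ) (j k : Fin d) (m : ZLat d) : ℝ :=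
  -∫ s in Set.Ioi (0 : ℝ), ∫ x : EuclideanSpace ℝ (Fin d),
      pHeatK d s x *
        (pderiv j (fun y => heatK d s y / pHeatK d s y) x *
         pderiv k (fun y => heatK d s (y - latVec m) / pHeatK d s y) x)

/-- The probabilistic discrete second-order Riesz transform 𝓡^{(jk)}. -/
def Rprob (d : ℕ) (j k : Fin d) (f : ZLat d → ℝ) (n : ZLat d) : ℝ :=
  ∑' m : ZLat d, probK d j k (n - m) * f m

/-- The ℓ^p norm of f : ℤ^d → ℝ. -/
def lpN (d : ℕ) (p : ℝ) (f : ZLat d → ℝ) : ℝ := (∑' n : ZLat d, |f n| ^ p) ^ (1 / p)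

/-- Membership in ℓ^p(ℤ^d). -/
def MemLpLat (d : ℕ) (p : ℝ) (f : ZLat d → ℝ) : Prop := Summable fun n : ZLat d => |f n| ^ p

/-- Operator norm of an operator on ℓ^p(ℤ^d): sup of ‖Tf‖ over ‖f‖ = 1. -/
def opN (d : ℕ) (p : ℝ) (T : (ZLat d → ℝ) → (ZLat d → ℝ)) : ℝ :=
  sSup {c : ℝ | ∃ f : ZLat d → ℝ, MemLpLat d p f ∧ lpN d p f = 1 ∧ c = lpN d p (T f)}

/-- p* = max{p, p/(p-1)}. -/
def pstar (p : ℝ) : ℝ := max p (p / (p - 1))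


/-- The ℓ^p norm of a complex-valued function on ℤ². -/
def lpNC (p : ℝ) (f : ZLat 2 → ℂ) : ℝ := (∑' n : ZLat 2, ‖f n‖ ^ p) ^ (1 / p)

/-- Membership in ℓ^p(ℤ²; ℂ). -/
def MemLpLatC (p : ℝ) (f : ZLat 2 → ℂ) : Prop := Summable fun n : ZLat 2 => ‖f n‖ ^ p

/-- Kernel of the probabilistic discrete Beurling–Ahlfors transform:
the (2,2) minus the (1,1) probabilistic kernel, plus 2i times the (2,1) one. -/
def BAker (m : ZLat 2) : ℂ :=
  ((probK 2 1 1 m - probK 2 0 0 m : ℝ) : ℂ) + 2 * Complex.I * ((probK 2 1 0 m : ℝ) : ℂ)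

/-- The probabilistic discrete Beurling–Ahlfors transform. -/
def BAdis (f : ZLat 2 → ℂ) (n : ZLat 2) : ℂ := ∑' m : ZLat 2, BAker (n - m) * f m

section Part1

def bu1 (x y : ℂ) : ℝ := if ‖x‖ + ‖y‖ ≤ 1 then ‖y‖ ^ 2 - ‖x‖ ^ 2 else 1 - 2 * ‖x‖

lemma bu1_sup (x y : ℂ) : ∃ A B : ℂ, ∀ h k : ℂ, ‖k‖ ≤ ‖h‖ →
    bu1 (x + h) (y + k) ≤ bu1 x y + inner ℝ A h + inner ℝ B k := by
  by_cases hD : ‖x‖ + ‖y‖ ≤ 1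
  · refine ⟨(-2 : ℝ) • x, (2 : ℝ) • y, fun h k hk => ?_⟩
    rw [real_inner_smul_left, real_inner_smul_left]
    have e1 := norm_add_sq_real x h
    have e2 := norm_add_sq_real y k
    have h0 := norm_nonneg x
    have h1 := norm_nonneg y
    have h2 := norm_nonneg h
    have h3 := norm_nonneg k
    have h4 := norm_nonneg (x + h)
    have h5 := norm_nonneg (y + k)
    have hk2 : ‖k‖ ^ 2 ≤ ‖h‖ ^ 2 := by gcongr
    unfold bu1
    rw [if_pos hD]
    split_ifs with hD'
    · nlinarith
    · push Not at hD'
      have key : (‖x + h‖ - 1) ^ 2 + ‖k‖ ^ 2 ≤ ‖y + k‖ ^ 2 + ‖h‖ ^ 2 := by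
        by_cases hx : ‖x + h‖ ≤ 1
        · nlinarith
        · push Not at hx
          have t1 : ‖x + h‖ ≤ ‖x‖ + ‖h‖ := norm_add_le _ _
          have t2 : (‖k‖ - ‖y‖) ^ 2 ≤ ‖y + k‖ ^ 2 := by
            rw [← sq_abs]
            have : |‖k‖ - ‖y‖| ≤ ‖y + k‖ := by
              have := abs_norm_sub_norm_le k (-y)
              rw [norm_neg, sub_neg_eq_add, add_comm k y] at this
              exact this
            gcongr
          have t3 : (‖x + h‖ - 1) ^ 2 ≤ (‖h‖ - ‖y‖) ^ 2 := by
            have : ‖x + h‖ - 1 ≤ ‖h‖ - ‖y‖ := by linarith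
            have : 0 ≤ ‖x + h‖ - 1 := by linarith
            gcongr
          nlinarith
      nlinarith
  · refine ⟨(-2 * ‖x‖⁻¹ : ℝ) • x, 0, fun h k hk => ?_⟩
    rw [real_inner_smul_left, inner_zero_left]
    have h4 := norm_nonneg (x + h)
    have h5 := norm_nonneg (y + k)
    have e : bu1 x y = 1 - 2 * ‖x‖ := by unfold bu1; rw [if_neg hD]
    have e' : bu1 (x + h) (y + k) ≤ 1 - 2 * ‖x + h‖ := by
      unfold bu1
      split_ifs with hD'
      · nlinarith
      · exact le_rfl
    have e2 : ‖x‖ + ‖x‖⁻¹ * inner ℝ x h ≤ ‖x + h‖ := by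
      by_cases hx : x = 0
      · simp [hx]
      · have hx' : 0 < ‖x‖ := norm_pos_iff.2 hx
        have := real_inner_le_norm x (x + h)
        rw [inner_add_right, real_inner_self_eq_norm_sq] at this
        have e3 : ‖x‖ + ‖x‖⁻¹ * inner ℝ x h = ‖x‖⁻¹ * (‖x‖ ^ 2 + inner ℝ x h) := by
          field_simp
        rw [e3, inv_mul_le_iff₀ hx']
        exact this
    rw [e]
    linarith

lemma bu1_sc (x y h k : ℂ) (a b : ℝ) (ha : 0 ≤ a) (hb : 0 ≤ b) (hab : a + b = 1)
    (hk : ‖k‖ ≤ ‖h‖) :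
    a * bu1 (x + b • h) (y + b • k) + b * bu1 (x - a • h) (y - a • k) ≤ bu1 x y := by
  obtain ⟨A, B, H⟩ := bu1_sup x y
  have h1 := H (b • h) (b • k) (by rw [norm_smul, norm_smul]; gcongr)
  have h2 := H (-(a • h)) (-(a • k)) (by rw [norm_neg, norm_neg, norm_smul, norm_smul]; gcongr)
  rw [← sub_eq_add_neg, ← sub_eq_add_neg, inner_neg_right, inner_neg_right,
    real_inner_smul_right, real_inner_smul_right] at h2
  rw [real_inner_smul_right, real_inner_smul_right] at h1
  have h1' := mul_le_mul_of_nonneg_left h1 ha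
  have h2' := mul_le_mul_of_nonneg_left h2 hb
  have : a * bu1 x y + b * bu1 x y = bu1 x y := by rw [← add_mul, hab, one_mul]
  nlinarith

/-- integral representation -/
lemma bu1_integral (p : ℝ) (hp : 1 < p) (hp2 : p < 2) (x y : ℂ) :
    IntegrableOn (fun t : ℝ => t ^ (p - 1) * bu1 (t⁻¹ • x) (t⁻¹ • y)) (Set.Ioi 0) ∧
    ∫ t in Set.Ioi (0 : ℝ), t ^ (p - 1) * bu1 (t⁻¹ • x) (t⁻¹ • y) =
      2 / (p * (2 - p)) * ((‖x‖ + ‖y‖) ^ (p - 1) * (‖y‖ - ‖x‖ / (p - 1))) := by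
  have key : ∀ t : ℝ, 0 < t → t ^ (p - 1) * bu1 (t⁻¹ • x) (t⁻¹ • y) =
      if ‖x‖ + ‖y‖ ≤ t then (‖y‖ ^ 2 - ‖x‖ ^ 2) * t ^ (p - 3)
        else t ^ (p - 1) - 2 * ‖x‖ * t ^ (p - 2) := by
    intro t ht
    have e1 : t ^ (p - 1) = t ^ (p - 3) * t ^ 2 := by
      rw [← rpow_natCast t 2, ← rpow_add ht]; congr 1; push_cast; ring
    have e2 : t ^ (p - 2) = t ^ (p - 3) * t := by
      nth_rewrite 3 [← rpow_one t]; rw [← rpow_add ht]; congr 1; ring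
    unfold bu1
    simp only [norm_smul, norm_inv, Real.norm_of_nonneg ht.le, ← mul_add, inv_mul_le_iff₀ ht,
      mul_one]
    split_ifs
    · rw [e1]; field_simp
    · rw [e1, e2]; field_simp
  rcases (add_nonneg (norm_nonneg x) (norm_nonneg y)).eq_or_lt with h0 | h0
  · have hx : ‖x‖ = 0 := by linarith [norm_nonneg x, norm_nonneg y]
    have hy : ‖y‖ = 0 := by linarith [norm_nonneg x, norm_nonneg y]
    have : Set.EqOn (fun t : ℝ => t ^ (p - 1) * bu1 (t⁻¹ • x) (t⁻¹ • y)) (fun _ => 0)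
        (Set.Ioi 0) := by
      intro t ht
      simp only
      rw [key t ht, if_pos (by rw [← h0]; exact le_of_lt ht), hx, hy]; simp
    constructor
    · exact (integrableOn_congr_fun this measurableSet_Ioi).2 integrableOn_zero
    · rw [setIntegral_congr_fun measurableSet_Ioi this, hx, hy]; simp
  set r := ‖x‖ + ‖y‖ with hr
  have E1 : Set.EqOn (fun t : ℝ => t ^ (p - 1) * bu1 (t⁻¹ • x) (t⁻¹ • y))
      (fun t => t ^ (p - 1) - 2 * ‖x‖ * t ^ (p - 2)) (Set.Ioo 0 r) := by
    intro t ht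
    simp only
    rw [key t ht.1, if_neg (not_le.2 ht.2)]
  have E2 : Set.EqOn (fun t : ℝ => t ^ (p - 1) * bu1 (t⁻¹ • x) (t⁻¹ • y))
      (fun t => (‖y‖ ^ 2 - ‖x‖ ^ 2) * t ^ (p - 3)) (Set.Ioi r) := by
    intro t ht
    simp only
    rw [key t (h0.trans ht), if_pos (le_of_lt ht)]
  have I1a : IntervalIntegrable (fun t : ℝ => t ^ (p - 1)) volume 0 r :=
    intervalIntegral.intervalIntegrable_rpow' (by linarith)
  have I1b : IntervalIntegrable (fun t : ℝ => 2 * ‖x‖ * t ^ (p - 2)) volume 0 r :=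
    (intervalIntegral.intervalIntegrable_rpow' (by linarith)).const_mul _
  have I1 := I1a.sub I1b
  have I1' := (intervalIntegrable_iff_integrableOn_Ioo_of_le h0.le).1 I1
  have J1 : IntegrableOn (fun t : ℝ => t ^ (p - 1) * bu1 (t⁻¹ • x) (t⁻¹ • y)) (Set.Ioc 0 r) := by
    rw [integrableOn_Ioc_iff_integrableOn_Ioo]
    exact (integrableOn_congr_fun E1 measurableSet_Ioo).2 I1'
  have I2 : IntegrableOn (fun t : ℝ => (‖y‖ ^ 2 - ‖x‖ ^ 2) * t ^ (p - 3)) (Set.Ioi r) :=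
    (integrableOn_Ioi_rpow_of_lt (by linarith) h0).const_mul _
  have J2 : IntegrableOn (fun t : ℝ => t ^ (p - 1) * bu1 (t⁻¹ • x) (t⁻¹ • y)) (Set.Ioi r) :=
    (integrableOn_congr_fun E2 measurableSet_Ioi).2 I2
  have hU : Set.Ioi (0:ℝ) = Set.Ioc 0 r ∪ Set.Ioi r := (Set.Ioc_union_Ioi_eq_Ioi h0.le).symm
  constructor
  · rw [hU]; exact J1.union J2
  · rw [hU, setIntegral_union (Set.Ioc_disjoint_Ioi le_rfl) measurableSet_Ioi J1 J2,
      setIntegral_congr_fun measurableSet_Ioi E2, integral_Ioc_eq_integral_Ioo,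
      setIntegral_congr_fun measurableSet_Ioo E1, ← integral_Ioc_eq_integral_Ioo,
      ← intervalIntegral.integral_of_le h0.le, intervalIntegral.integral_sub I1a I1b,
      intervalIntegral.integral_const_mul, integral_rpow (Or.inl (by linarith)),
      integral_rpow (Or.inl (by linarith)), integral_const_mul,
      integral_Ioi_rpow_of_lt (by linarith) h0]
    have z1 : p - 1 + 1 ≠ 0 := by linarith
    have z2 : p - 2 + 1 ≠ 0 := by linarith
    have z3 : p - 3 + 1 ≠ 0 := by linarith
    rw [zero_rpow z1, zero_rpow z2]
    have e0 : r ^ (p - 1 + 1) = r ^ (p - 3 + 1) * r ^ 2 := by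
      rw [← rpow_natCast r 2, ← rpow_add h0]; congr 1; push_cast; ring
    have e1 : r ^ (p - 1) = r ^ (p - 3 + 1) * r := by
      nth_rewrite 3 [← rpow_one r]; rw [← rpow_add h0]; congr 1; ring
    have e2 : r ^ (p - 2 + 1) = r ^ (p - 3 + 1) * r := by
      nth_rewrite 3 [← rpow_one r]; rw [← rpow_add h0]; congr 1; ring
    rw [e0, e1, e2]
    have z4 : p - 1 ≠ 0 := by linarith
    have z5 : 2 - p ≠ 0 := by linarith
    have z6 : p ≠ 0 := by linarith
    rw [show p - 1 + 1 = p by ring, show p - 2 + 1 = p - 1 by ring, show p - 3 + 1 = -(2 - p) by ring,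
      hr]
    field_simp
    ring

/-- numeric inequality -/
lemma burk_amgm (p : ℝ) (hp : 1 < p) (hp2 : p < 2) (m X : ℝ) (hm : 0 ≤ m) (hX : 0 < X) :
    m ^ (p - 1) ≤ X ^ (p - 2) * ((p - 1) * m + (2 - p) * X) := by
  have h := Real.geom_mean_le_arith_mean2_weighted (w₁ := p - 1) (w₂ := 2 - p) (by linarith)
    (by linarith) hm hX.le (by ring)
  have e : X ^ (p - 2) * X ^ (2 - p) = 1 := by
    rw [← rpow_add hX]; simp
  have h2 := mul_le_mul_of_nonneg_left h (rpow_nonneg hX.le (p - 2))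
  calc m ^ (p - 1) = X ^ (p - 2) * (m ^ (p - 1) * X ^ (2 - p)) := by
        rw [mul_left_comm, e, mul_one]
    _ ≤ _ := h2

lemma burk_num (p : ℝ) (hp : 1 < p) (hp2 : p < 2) (A b : ℝ) (hA : 0 ≤ A) (hb : 0 ≤ b) :
    b ^ p - A ^ p ≤ p * (((p - 1) * A + b) / p) ^ (p - 1) * (b - A) := by
  have hp0 : 0 < p := by linarith
  set m := ((p - 1) * A + b) / p with hm
  have hmp : p * m = (p - 1) * A + b := by rw [hm]; field_simp
  have hm0 : 0 ≤ m := by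
    have : 0 ≤ (p - 1) * A := mul_nonneg (by linarith) hA
    rw [hm]; positivity
  rcases lt_or_ge A b with hAb | hAb
  · have hmpos : 0 < m := by
      have : 0 ≤ (p - 1) * A := mul_nonneg (by linarith) hA
      have : 0 < p * m := by linarith
      exact pos_of_mul_pos_right this hp0.le
    have I : ∫ t in A..b, t ^ (p - 1) = (b ^ p - A ^ p) / p := by
      rw [integral_rpow (Or.inl (by linarith))]; simp
    have I2 : ∫ t in A..b, m ^ (p - 2) * ((p - 1) * t + (2 - p) * m) =
        m ^ (p - 2) * ((p - 1) * ((b ^ 2 - A ^ 2) / 2) + (b - A) * ((2 - p) * m)) := by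
      rw [intervalIntegral.integral_const_mul, intervalIntegral.integral_add,
        intervalIntegral.integral_const_mul, integral_id, intervalIntegral.integral_const, smul_eq_mul]
      · exact (continuous_const.mul continuous_id).intervalIntegrable _ _
      · exact continuous_const.intervalIntegrable _ _
    have le : ∫ t in A..b, t ^ (p - 1) ≤ ∫ t in A..b, m ^ (p - 2) * ((p - 1) * t + (2 - p) * m) := by
      apply intervalIntegral.integral_mono_on hAb.le
      · exact intervalIntegral.intervalIntegrable_rpow' (by linarith)
      · exact (by fun_prop : Continuous fun t : ℝ => m ^ (p - 2) * ((p - 1) * t + (2 - p) * m)).intervalIntegrable _ _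
      · intro t ht
        exact burk_amgm p hp hp2 t m (hA.trans ht.1) hmpos
    rw [I, I2, div_le_iff₀ hp0] at le
    refine le.trans ?_
    have e : m ^ (p - 1) = m ^ (p - 2) * m := by
      nth_rewrite 3 [← rpow_one m]; rw [← rpow_add hmpos]; congr 1; ring
    rw [e]
    have hT : 0 < m ^ (p - 2) := rpow_pos_of_pos hmpos _
    have hmid : (A + b) / 2 ≤ m := by
      rw [hm, le_div_iff₀ hp0]; nlinarith
    have : (p - 1) * ((b ^ 2 - A ^ 2) / 2) + (b - A) * ((2 - p) * m) ≤ m * (b - A) := by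
      have h1 : 0 ≤ (p - 1) * (b - A) := mul_nonneg (by linarith) (by linarith)
      nlinarith [mul_le_mul_of_nonneg_left hmid h1]
    calc _ ≤ m ^ (p - 2) * (m * (b - A)) * p := by gcongr
      _ = _ := by ring
  · rcases hA.eq_or_lt with h0 | h0
    · have : b = 0 := by linarith
      simp [this, ← h0]
    have h1 := burk_amgm p hp hp2 m A hm0 h0
    have h2 := burk_amgm p hp hp2 b A hb h0
    have e : A ^ p = A ^ (p - 2) * A ^ 2 := by
      rw [← rpow_natCast A 2, ← rpow_add h0]; congr 1; push_cast; ring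
    have e2 : b ^ p = b ^ (p - 1) * b := by
      rcases hb.eq_or_lt with hb0 | hb0
      · rw [← hb0, zero_rpow hp0.ne']; simp
      · nth_rewrite 3 [← rpow_one b]; rw [← rpow_add hb0]; congr 1; ring
    rw [e, e2]
    have hT : 0 < A ^ (p - 2) := rpow_pos_of_pos h0 _
    set T := A ^ (p - 2)
    have h1' : p * m ^ (p - 1) * (A - b) ≤ T * (A + (p - 1) * b) * (A - b) := by
      have : p * m ^ (p - 1) ≤ T * (A + (p - 1) * b) := by
        calc p * m ^ (p - 1) ≤ p * (T * ((p - 1) * m + (2 - p) * A)) := by gcongr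
          _ = T * ((p - 1) * (p * m) + p * (2 - p) * A) := by ring
          _ = _ := by rw [hmp]; ring
      have : 0 ≤ A - b := by linarith
      gcongr
    have h2' := mul_le_mul_of_nonneg_right h2 hb
    nlinarith

structure Bell (Φ : ℂ × ℂ → ℝ) : Prop where
  nonneg : ∀ w, 0 ≤ Φ w
  sc : ∀ (w₁ w₂ : ℂ × ℂ) (a b : ℝ), 0 ≤ a → 0 ≤ b → a + b = 1 →
    Φ (a • w₁ + b • w₂) + a * b * (‖w₁.1 - w₂.1‖ * ‖w₁.2 - w₂.2‖) ≤ a * Φ w₁ + b * Φ w₂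

def bW (p : ℝ) (x y : ℂ) : ℝ :=
  ((p - 1) / p) ^ (p - 1) * ((‖x‖ + ‖y‖) ^ (p - 1) * (‖y‖ - ‖x‖ / (p - 1)))

lemma bW_sc (p : ℝ) (hp : 1 < p) (hp2 : p < 2) (x y h k : ℂ) (a b : ℝ) (ha : 0 ≤ a) (hb : 0 ≤ b)
    (hab : a + b = 1) (hk : ‖k‖ ≤ ‖h‖) :
    a * bW p (x + b • h) (y + b • k) + b * bW p (x - a • h) (y - a • k) ≤ bW p x y := by
  have hc : 0 < 2 / (p * (2 - p)) := by
    have : 0 < 2 - p := by linarith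
    positivity
  have hc2 : 0 ≤ ((p - 1) / p) ^ (p - 1) := by
    have : 0 < p - 1 := by linarith
    positivity
  obtain ⟨i1, e1⟩ := bu1_integral p hp hp2 (x + b • h) (y + b • k)
  obtain ⟨i2, e2⟩ := bu1_integral p hp hp2 (x - a • h) (y - a • k)
  obtain ⟨i3, e3⟩ := bu1_integral p hp hp2 x y
  have main : (∫ t in Set.Ioi (0 : ℝ), (a * (t ^ (p - 1) * bu1 (t⁻¹ • (x + b • h)) (t⁻¹ • (y + b • k)))
      + b * (t ^ (p - 1) * bu1 (t⁻¹ • (x - a • h)) (t⁻¹ • (y - a • k)))))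
      ≤ ∫ t in Set.Ioi (0 : ℝ), t ^ (p - 1) * bu1 (t⁻¹ • x) (t⁻¹ • y) := by
    apply setIntegral_mono_on ((i1.const_mul a).add (i2.const_mul b)) i3 measurableSet_Ioi
    intro t ht
    have ht' : 0 < t := ht
    have := bu1_sc (t⁻¹ • x) (t⁻¹ • y) (t⁻¹ • h) (t⁻¹ • k) a b ha hb hab
      (by rw [norm_smul, norm_smul]; gcongr)
    have h2 := mul_le_mul_of_nonneg_left this (rpow_nonneg ht'.le (p - 1))
    show a * (t ^ (p - 1) * bu1 (t⁻¹ • (x + b • h)) (t⁻¹ • (y + b • k)))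
      + b * (t ^ (p - 1) * bu1 (t⁻¹ • (x - a • h)) (t⁻¹ • (y - a • k)))
      ≤ t ^ (p - 1) * bu1 (t⁻¹ • x) (t⁻¹ • y)
    rw [smul_add, smul_add, smul_sub, smul_sub, smul_comm t⁻¹ b h, smul_comm t⁻¹ b k,
      smul_comm t⁻¹ a h, smul_comm t⁻¹ a k]
    linarith
  rw [integral_add (i1.const_mul a) (i2.const_mul b), integral_const_mul, integral_const_mul, e1, e2,
    e3] at main
  unfold bW
  have main2 : a * ((‖x + b • h‖ + ‖y + b • k‖) ^ (p - 1) * (‖y + b • k‖ - ‖x + b • h‖ / (p - 1)))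
    + b * ((‖x - a • h‖ + ‖y - a • k‖) ^ (p - 1) * (‖y - a • k‖ - ‖x - a • h‖ / (p - 1)))
    ≤ (‖x‖ + ‖y‖) ^ (p - 1) * (‖y‖ - ‖x‖ / (p - 1)) := by
    refine le_of_mul_le_mul_left ?_ hc
    linarith
  have := mul_le_mul_of_nonneg_left main2 hc2
  linarith

lemma bW_upper (p q : ℝ) (hp : 1 < p) (hp2 : p < 2) (hpq : p.HolderConjugate q) (x y η : ℂ) :
    inner ℝ y η - bW p x y ≤ (1 / (p - 1)) * (‖x‖ ^ p / p + ‖η‖ ^ q / q) := by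
  have hp0 : 0 < p := by linarith
  have hp1 : 0 < p - 1 := by linarith
  have hnum := burk_num p hp hp2 (‖x‖ / (p - 1)) ‖y‖ (by positivity) (norm_nonneg _)
  rw [show (p - 1) * (‖x‖ / (p - 1)) = ‖x‖ by field_simp] at hnum
  have hW : bW p x y = (p - 1) ^ (p - 1) / p * (p * ((‖x‖ + ‖y‖) / p) ^ (p - 1) * (‖y‖ - ‖x‖ / (p - 1))) := by
    unfold bW
    rw [div_rpow hp1.le hp0.le, div_rpow (by positivity) hp0.le]
    field_simp
  have h1 : (p - 1) ^ (p - 1) / p * (‖y‖ ^ p - (‖x‖ / (p - 1)) ^ p) ≤ bW p x y := by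
    rw [hW]; gcongr
  have h2 : (p - 1) ^ (p - 1) / p * (‖x‖ / (p - 1)) ^ p = 1 / (p - 1) * (‖x‖ ^ p / p) := by
    rw [div_rpow (norm_nonneg _) hp1.le]
    have : (p - 1) ^ p = (p - 1) ^ (p - 1) * (p - 1) := by
      rw [← rpow_add_one hp1.ne']; congr 1; ring
    rw [this]
    have := rpow_pos_of_pos hp1 (p - 1)
    field_simp
  have hin : inner ℝ y η ≤ ‖y‖ * ‖η‖ := real_inner_le_norm y η
  have hy := Real.young_inequality_of_nonneg (a := (p - 1) ^ (1 / q) * ‖y‖)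
    (b := (p - 1) ^ (-(1 / q)) * ‖η‖) (by positivity) (by positivity) hpq
  have q0 : 0 < q := hpq.symm.pos
  have eA : (p - 1) ^ (1 / q) * ‖y‖ * ((p - 1) ^ (-(1 / q)) * ‖η‖) = ‖y‖ * ‖η‖ := by
    rw [rpow_neg hp1.le]
    have := rpow_pos_of_pos hp1 (1 / q)
    field_simp
  have eB : ((p - 1) ^ (1 / q) * ‖y‖) ^ p = (p - 1) ^ (p - 1) * ‖y‖ ^ p := by
    rw [mul_rpow (by positivity) (norm_nonneg _), ← rpow_mul hp1.le]
    congr 2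
    have := hpq.sub_one_mul_conj
    field_simp
    linarith
  have eC : ((p - 1) ^ (-(1 / q)) * ‖η‖) ^ q = 1 / (p - 1) * ‖η‖ ^ q := by
    rw [mul_rpow (by positivity) (norm_nonneg _), ← rpow_mul hp1.le]
    congr 1
    rw [show -(1 / q) * q = -1 by field_simp, rpow_neg_one, one_div]
  rw [eA, eB, eC] at hy
  have : 1 / (p - 1) * (‖x‖ ^ p / p + ‖η‖ ^ q / q) = 1 / (p - 1) * (‖x‖ ^ p / p) + 1 / (p - 1) * ‖η‖ ^ q / q := by ring
  rw [this, ← h2]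
  have : (p - 1) ^ (p - 1) / p * (‖y‖ ^ p - (‖x‖ / (p - 1)) ^ p) =
    (p - 1) ^ (p - 1) * ‖y‖ ^ p / p - (p - 1) ^ (p - 1) / p * (‖x‖ / (p - 1)) ^ p := by ring
  linarith

def bPhi (p : ℝ) (w : ℂ × ℂ) : ℝ := ⨆ y : ℂ, (inner ℝ y w.2 - bW p w.1 y)

lemma bPhi_bdd (p q : ℝ) (hp : 1 < p) (hp2 : p < 2) (hpq : p.HolderConjugate q) (w : ℂ × ℂ) :
    BddAbove (Set.range fun y : ℂ => (inner ℝ y w.2 - bW p w.1 y)) :=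
  ⟨_, by rintro _ ⟨y, rfl⟩; exact bW_upper p q hp hp2 hpq w.1 y w.2⟩

lemma exists_k (h κ : ℂ) : ∃ k : ℂ, ‖k‖ ≤ ‖h‖ ∧ inner ℝ k κ = ‖h‖ * ‖κ‖ := by
  by_cases hκ : κ = 0
  · exact ⟨0, by simp, by simp [hκ]⟩
  · have : 0 < ‖κ‖ := norm_pos_iff.2 hκ
    refine ⟨(‖h‖ / ‖κ‖) • κ, ?_, ?_⟩
    · rw [norm_smul, Real.norm_of_nonneg (by positivity)]; field_simp; rfl
    · rw [real_inner_smul_left, real_inner_self_eq_norm_sq]; field_simp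

lemma bPhi_bell (p q : ℝ) (hp : 1 < p) (hp2 : p < 2) (hpq : p.HolderConjugate q) :
    Bell (bPhi p) := by
  have hp0 : 0 < p := by linarith
  have hp1 : 0 < p - 1 := by linarith
  constructor
  · intro w
    refine le_trans ?_ (le_ciSup (bPhi_bdd p q hp hp2 hpq w) 0)
    unfold bW
    simp only [inner_zero_left, norm_zero, zero_sub, add_zero, mul_neg, neg_neg]
    positivity
  · intro w₁ w₂ a b ha hb hab
    rw [← le_sub_iff_add_le]
    apply ciSup_le
    intro y
    obtain ⟨k, hk, hk2⟩ := exists_k (w₁.1 - w₂.1) (w₁.2 - w₂.2)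
    have h1 := le_ciSup (bPhi_bdd p q hp hp2 hpq w₁) (y + b • k)
    have h2 := le_ciSup (bPhi_bdd p q hp hp2 hpq w₂) (y - a • k)
    have hs := bW_sc p hp hp2 (a • w₁ + b • w₂).1 y (w₁.1 - w₂.1) k a b ha hb hab hk
    have ea : a = 1 - b := by linarith
    have x1 : (a • w₁ + b • w₂).1 + b • (w₁.1 - w₂.1) = w₁.1 := by
      simp only [Prod.fst_add, Prod.smul_fst, ea]; module
    have x2 : (a • w₁ + b • w₂).1 - a • (w₁.1 - w₂.1) = w₂.1 := by
      simp only [Prod.fst_add, Prod.smul_fst, ea]; module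
    rw [x1, x2] at hs
    have h1' := mul_le_mul_of_nonneg_left h1 ha
    have h2' := mul_le_mul_of_nonneg_left h2 hb
    have hin : inner ℝ y (a • w₁ + b • w₂).2 + a * b * (‖w₁.1 - w₂.1‖ * ‖w₁.2 - w₂.2‖)
        = a * inner ℝ (y + b • k) w₁.2 + b * inner ℝ (y - a • k) w₂.2 := by
      rw [← hk2]
      simp only [Prod.snd_add, Prod.smul_snd, inner_add_right, inner_add_left, inner_sub_left,
        inner_sub_right, real_inner_smul_left, real_inner_smul_right]
      ring
    unfold bPhi
    linarith

lemma bell_two : Bell (fun w => (‖w.1‖ ^ 2 + ‖w.2‖ ^ 2) / 2) := by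
  constructor
  · intro w; positivity
  · intro w₁ w₂ a b ha hb hab
    have key : ∀ x y : ℂ, ‖a • x + b • y‖ ^ 2 + a * b * ‖x - y‖ ^ 2 = a * ‖x‖ ^ 2 + b * ‖y‖ ^ 2 := by
      intro x y
      rw [norm_add_sq_real, norm_sub_sq_real, norm_smul, norm_smul, real_inner_smul_left,
        real_inner_smul_right, Real.norm_of_nonneg ha, Real.norm_of_nonneg hb]
      have : b = 1 - a := by linarith
      rw [this]; ring
    have k1 := key w₁.1 w₂.1
    have k2 := key w₁.2 w₂.2
    simp only [Prod.fst_add, Prod.smul_fst, Prod.snd_add, Prod.smul_snd]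
    have : 0 ≤ a * b := by positivity
    nlinarith [mul_nonneg this (sq_nonneg (‖w₁.1 - w₂.1‖ - ‖w₁.2 - w₂.2‖))]

lemma Bell.swap {Φ : ℂ × ℂ → ℝ} (h : Bell Φ) : Bell (fun w => Φ w.swap) := by
  constructor
  · intro w; exact h.nonneg _
  · intro w₁ w₂ a b ha hb hab
    have := h.sc w₁.swap w₂.swap a b ha hb hab
    simp only [Prod.swap_add, Prod.smul_swap]
    simp only [Prod.fst_swap, Prod.snd_swap] at this
    linarith [mul_comm ‖w₁.1 - w₂.1‖ ‖w₁.2 - w₂.2‖ ▸ this]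

lemma bell_exists (p q : ℝ) (hpq : p.HolderConjugate q) :
    ∃ Φ, Bell Φ ∧ ∀ x η : ℂ, Φ (x, η) ≤ (pstar p - 1) * (‖x‖ ^ p / p + ‖η‖ ^ q / q) := by
  have small : ∀ p q : ℝ, p.HolderConjugate q → p < 2 →
    ∃ Φ, Bell Φ ∧ ∀ x η : ℂ, Φ (x, η) ≤ (1 / (p - 1)) * (‖x‖ ^ p / p + ‖η‖ ^ q / q) := by
    intro p q hpq hp2
    exact ⟨bPhi p, bPhi_bell p q hpq.lt hp2 hpq, fun x η => ciSup_le fun y =>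
      bW_upper p q hpq.lt hp2 hpq x y η⟩
  have hp := hpq.lt
  have hp1 : 0 < p - 1 := by linarith
  have hconj : q = p / (p - 1) := hpq.conjugate_eq
  rcases lt_trichotomy p 2 with h | h | h
  · obtain ⟨Φ, h1, h2⟩ := small p q hpq h
    refine ⟨Φ, h1, ?_⟩
    have : pstar p - 1 = 1 / (p - 1) := by
      unfold pstar
      rw [max_eq_right]
      · field_simp; ring
      · rw [le_div_iff₀ hp1]; nlinarith
    rw [this]; exact h2
  · have hq : q = 2 := by rw [hconj, h]; norm_num
    have : pstar p - 1 = 1 := by unfold pstar; rw [h]; norm_num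
    refine ⟨_, bell_two, ?_⟩
    intro x η
    rw [this, h, hq]
    simp only [rpow_two]
    linarith
  · have hq2 : q < 2 := by rw [hconj, div_lt_iff₀ hp1]; linarith
    obtain ⟨Φ, h1, h2⟩ := small q p hpq.symm hq2
    refine ⟨_, h1.swap, ?_⟩
    have : pstar p - 1 = 1 / (q - 1) := by
      unfold pstar
      rw [max_eq_left]
      · have hq1 : 0 < q - 1 := by linarith [hpq.symm.lt]
        have := hpq.sub_one_mul_conj
        rw [eq_div_iff hq1.ne']; linarith
      · rw [div_le_iff₀ hp1]; nlinarith
    rw [this]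
    intro x η
    have := h2 η x
    simp only [Prod.swap_prod_mk]
    linarith

end Part1

section Part2

abbrev E2 := EuclideanSpace ℝ (Fin 2)

lemma heatK_eq (s : ℝ) (y : E2) : heatK 2 s y = (2 * π * s)⁻¹ * Real.exp (-‖y‖ ^ 2 / (2 * s)) := by
  unfold heatK
  rw [show (-((2 : ℕ) : ℝ) / 2) = -1 by norm_num, rpow_neg_one]

lemma heatK_pos {s : ℝ} (hs : 0 < s) (y : E2) : 0 < heatK 2 s y := by
  rw [heatK_eq]; positivity

lemma heatK_neg (s : ℝ) (y : E2) : heatK 2 s (-y) = heatK 2 s y := by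
  rw [heatK_eq, heatK_eq, norm_neg]

lemma latVec_add (m n : ZLat 2) : latVec (m + n) = latVec m + latVec n := by
  ext i; simp [latVec]

lemma latVec_neg (m : ZLat 2) : latVec (-m) = -latVec m := by
  ext i; simp [latVec]

lemma latVec_sub (m n : ZLat 2) : latVec (m - n) = latVec m - latVec n := by
  ext i; simp [latVec]

lemma latVec_zero : latVec (0 : ZLat 2) = 0 := by
  ext i; simp [latVec]

lemma norm_latVec (m : ZLat 2) : ‖latVec m‖ ^ 2 = (m 0 : ℝ) ^ 2 + (m 1 : ℝ) ^ 2 := by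
  rw [EuclideanSpace.norm_sq_eq]; simp [latVec, Fin.sum_univ_two]

lemma summ_int (a : ℝ) (ha : 0 < a) : Summable fun n : ℤ => Real.exp (-a * (n : ℝ) ^ 2) := by
  have hN : Summable fun n : ℕ => Real.exp (-a * (n : ℝ) ^ 2) := by
    have h1 : Summable fun n : ℕ => (Real.exp (-a)) ^ n :=
      summable_geometric_of_lt_one (Real.exp_pos _).le (by rw [Real.exp_lt_one_iff]; linarith)
    refine h1.of_nonneg_of_le (fun n => (Real.exp_pos _).le) (fun n => ?_)
    rw [← Real.exp_nat_mul]
    apply Real.exp_le_exp.2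
    have : (n : ℝ) ≤ (n : ℝ) ^ 2 := by
      have : n ≤ n ^ 2 := Nat.le_self_pow (by norm_num) n
      exact_mod_cast this
    nlinarith
  refine Summable.of_nat_of_neg ?_ ?_
  · simpa using hN
  · simpa using hN

lemma summ_lat (a : ℝ) (ha : 0 < a) : Summable fun n : ZLat 2 => Real.exp (-a * ‖latVec n‖ ^ 2) := by
  have h := (summ_int a ha).mul_of_nonneg (summ_int a ha) (fun n => (Real.exp_pos _).le)
    (fun n => (Real.exp_pos _).le)
  have h2 := (finTwoArrowEquiv ℤ).summable_iff.2 h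
  refine h2.congr (fun n => ?_)
  rw [norm_latVec]
  show Real.exp (-a * (n 0 : ℝ) ^ 2) * Real.exp (-a * (n 1 : ℝ) ^ 2) = _
  rw [← Real.exp_add]
  congr 1; ring

lemma gauss_loc (a R : ℝ) (ha : 0 < a) (x v : E2) (hx : ‖x‖ ≤ R) :
    Real.exp (-a * ‖x - v‖ ^ 2) ≤ Real.exp (a * R ^ 2) * Real.exp (-(a / 2) * ‖v‖ ^ 2) := by
  rw [← Real.exp_add]
  apply Real.exp_le_exp.2
  have h1 : ‖v‖ ≤ ‖x‖ + ‖x - v‖ := by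
    calc ‖v‖ = ‖x - (x - v)‖ := by congr 1; abel
      _ ≤ _ := norm_sub_le _ _
  have h2 : ‖v‖ ^ 2 ≤ 2 * ‖x‖ ^ 2 + 2 * ‖x - v‖ ^ 2 := by
    have := pow_le_pow_left₀ (norm_nonneg v) h1 2
    nlinarith [sq_nonneg (‖x‖ - ‖x - v‖)]
  have h3 : ‖x‖ ^ 2 ≤ R ^ 2 := pow_le_pow_left₀ (norm_nonneg _) hx 2
  nlinarith

lemma summ_gauss (a : ℝ) (ha : 0 < a) (x : E2) :
    Summable fun n : ZLat 2 => Real.exp (-a * ‖x - latVec n‖ ^ 2) :=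
  ((summ_lat (a / 2) (by positivity)).mul_left (Real.exp (a * ‖x‖ ^ 2))).of_nonneg_of_le
    (fun n => (Real.exp_pos _).le) (fun n => gauss_loc a ‖x‖ ha x _ le_rfl)

lemma summ_heat {s : ℝ} (hs : 0 < s) (x : E2) :
    Summable fun n : ZLat 2 => heatK 2 s (x - latVec n) := by
  have := (summ_gauss (1 / (2 * s)) (by positivity) x).mul_left ((2 * π * s)⁻¹)
  refine this.congr (fun n => ?_)
  rw [heatK_eq]; congr 2; ring

lemma pHeatK_pos {s : ℝ} (hs : 0 < s) (x : E2) : 0 < pHeatK 2 s x :=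
  (summ_heat hs x).tsum_pos (fun n => (heatK_pos hs _).le) 0 (heatK_pos hs _)

lemma heatK_hasFDerivAt (s : ℝ) (v x : E2) :
    HasFDerivAt (fun y => heatK 2 s (y - v))
      ((heatK 2 s (x - v) * (-1 / s)) • innerSL ℝ (x - v)) x := by
  have h1 : HasFDerivAt (fun y : E2 => ‖y - v‖ ^ 2) (2 • (innerSL ℝ (x - v)).comp (ContinuousLinearMap.id ℝ E2)) x :=
    ((hasFDerivAt_id x).sub_const v).norm_sq
  have h2 := ((h1.const_mul (-1 / (2 * s))).exp).const_mul ((2 * π * s)⁻¹)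
  have h3 : (fun y => heatK 2 s (y - v)) =
      fun y => (2 * π * s)⁻¹ * Real.exp (-1 / (2 * s) * ‖y - v‖ ^ 2) := by
    ext y; rw [heatK_eq]; congr 2; ring
  rw [h3]
  refine h2.congr_fderiv ?_
  refine ContinuousLinearMap.ext fun y => ?_
  rw [heatK_eq]
  simp only [ContinuousLinearMap.smul_apply, smul_eq_mul, innerSL_apply_apply, ContinuousLinearMap.comp_apply,
    ContinuousLinearMap.id_apply, nsmul_eq_mul]
  rw [show -1 / (2 * s) * ‖x - v‖ ^ 2 = -‖x - v‖ ^ 2 / (2 * s) by ring]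
  push_cast
  by_cases hs : s = 0
  · simp [hs]
  · field_simp

lemma pHeatK_diff {s : ℝ} (hs : 0 < s) : Differentiable ℝ (pHeatK 2 s) := by
  intro x
  set R := ‖x‖ + 1 with hR
  set a := 1 / (4 * s) with hadef
  have ha : 0 < a := by positivity
  set C := (2 * π * s)⁻¹ / s * (1 + 4 * s) with hC
  have hC0 : 0 < C := by positivity
  have hu : Summable fun n : ZLat 2 => C * (Real.exp (a * R ^ 2) * Real.exp (-(a / 2) * ‖latVec n‖ ^ 2)) :=
    ((summ_lat (a / 2) (by positivity)).mul_left _).mul_left _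
  refine (hasFDerivAt_tsum_of_isPreconnected (f := fun (n : ZLat 2) (y : E2) => heatK 2 s (y - latVec n)) hu
    (Metric.isOpen_ball (x := (0 : E2)) (ε := R)) (convex_ball _ _).isPreconnected
    (fun n y _ => heatK_hasFDerivAt s (latVec n) y) ?_ (x₀ := x) ?_ (summ_heat hs x) ?_).differentiableAt
  · intro n y hy
    refine le_trans ?_ (mul_le_mul_of_nonneg_left (gauss_loc a R ha y (latVec n) (mem_ball_zero_iff.1 hy).le) hC0.le)
    rw [norm_smul, innerSL_apply_norm, heatK_eq, norm_mul, norm_div, norm_neg, norm_one,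
      Real.norm_of_nonneg hs.le, Real.norm_of_nonneg (by positivity)]
    set r := ‖y - latVec n‖
    have e1 : -r ^ 2 / (2 * s) = -a * r ^ 2 + -a * r ^ 2 := by rw [hadef]; field_simp; ring
    rw [e1, Real.exp_add]
    have h1 : r * Real.exp (-a * r ^ 2) ≤ 1 + 4 * s := by
      have h2 : a * r ^ 2 + 1 ≤ Real.exp (a * r ^ 2) := Real.add_one_le_exp _
      have h3 : r ≤ (1 + 4 * s) * Real.exp (a * r ^ 2) := by
        have h4 : r ≤ 1 + r ^ 2 := by nlinarith [sq_nonneg (r - 1)]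
        have h5 : r ^ 2 = 4 * s * (a * r ^ 2) := by rw [hadef]; field_simp
        have h6 : 0 ≤ a * r ^ 2 := by positivity
        nlinarith
      rw [show -a * r ^ 2 = -(a * r ^ 2) by ring, Real.exp_neg]
      rw [← div_eq_mul_inv, div_le_iff₀ (Real.exp_pos _)]
      exact h3
    rw [hC]
    have h0 : 0 ≤ (2 * π * s)⁻¹ / s * Real.exp (-a * r ^ 2) := by positivity
    calc _ = (2 * π * s)⁻¹ / s * Real.exp (-a * r ^ 2) * (r * Real.exp (-a * r ^ 2)) := by ring
      _ ≤ (2 * π * s)⁻¹ / s * Real.exp (-a * r ^ 2) * (1 + 4 * s) := by gcongr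
      _ = _ := by ring
  · simp [hR]
  · simp [hR]

lemma heatK_diff (s : ℝ) (v : E2) : Differentiable ℝ fun y => heatK 2 s (y - v) :=
  fun x => (heatK_hasFDerivAt s v x).differentiableAt

lemma pHeatK_periodic (s : ℝ) (x : E2) (m : ZLat 2) : pHeatK 2 s (x - latVec m) = pHeatK 2 s x := by
  unfold pHeatK
  rw [← (Equiv.addLeft m).tsum_eq (fun n => heatK 2 s (x - latVec n))]
  refine tsum_congr (fun n => ?_)
  rw [Equiv.coe_addLeft, latVec_add]; congr 1; abel

lemma pHeatK_neg (s : ℝ) (x : E2) : pHeatK 2 s (-x) = pHeatK 2 s x := by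
  unfold pHeatK
  rw [← (Equiv.neg (ZLat 2)).tsum_eq (fun n => heatK 2 s (x - latVec n))]
  refine tsum_congr (fun n => ?_)
  rw [Equiv.neg_apply, latVec_neg, ← heatK_neg]; congr 1; abel

lemma heatK_meas (v : E2) : Measurable fun z : ℝ × E2 => heatK 2 z.1 (z.2 - v) := by
  simp only [heatK_eq]
  fun_prop

lemma pHeatK_meas : Measurable fun z : ℝ × E2 => pHeatK 2 z.1 z.2 := by
  unfold pHeatK
  exact Measurable.tsum (fun n => heatK_meas _)

lemma heatK_int {r : ℝ} (hr : 0 < r) : Integrable (heatK 2 r) ∧ ∫ x, heatK 2 r x = 1 := by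
  have h := GaussianFourier.integral_rexp_neg_mul_sq_norm (V := E2) (b := 1 / (2 * r)) (by positivity)
  have hf : heatK 2 r = fun x => (2 * π * r)⁻¹ * Real.exp (-(1 / (2 * r)) * ‖x‖ ^ 2) := by
    ext x; rw [heatK_eq]; congr 2; ring
  have h2 : ∫ v : E2, Real.exp (-(1 / (2 * r)) * ‖v‖ ^ 2) = 2 * π * r := by
    rw [h]; simp; field_simp
  rw [hf]
  constructor
  · refine Integrable.const_mul ?_ _
    by_contra hc
    rw [integral_undef hc] at h2
    have : 0 < 2 * π * r := by positivity
    linarith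
  · rw [integral_const_mul, h2]
    exact inv_mul_cancel₀ (by positivity)

lemma heatK_lint {r : ℝ} (hr : 0 < r) (v : E2) : ∫⁻ x, ENNReal.ofReal (heatK 2 r (x - v)) = 1 := by
  rw [lintegral_sub_right_eq_self (fun x => ENNReal.ofReal (heatK 2 r x)) v,
    ← ofReal_integral_eq_lintegral_ofReal (heatK_int hr).1 (ae_of_all _ fun x => (heatK_pos hr x).le),
    (heatK_int hr).2, ENNReal.ofReal_one]

/-- standard Gaussian measure -/
def gam : Measure E2 := volume.withDensity fun x => ENNReal.ofReal (heatK 2 1 x)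

lemma heatK1_meas : Measurable fun x : E2 => ENNReal.ofReal (heatK 2 1 x) := by
  simp only [heatK_eq]
  fun_prop

lemma gam_lint {f : E2 → ENNReal} (hf : Measurable f) :
    ∫⁻ x, f x ∂gam = ∫⁻ x, ENNReal.ofReal (heatK 2 1 x) * f x := by
  unfold gam
  rw [lintegral_withDensity_eq_lintegral_mul _ heatK1_meas hf]
  rfl

instance : IsProbabilityMeasure gam := ⟨by
  rw [← lintegral_one, gam_lint measurable_const]
  simpa using heatK_lint one_pos 0⟩

lemma gam_iso (T : E2 ≃ₗᵢ[ℝ] E2) {f : E2 → ENNReal} (hf : Measurable f) :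
    ∫⁻ x, f (T x) ∂gam = ∫⁻ x, f x ∂gam := by
  have hT : Measurable T := T.continuous.measurable
  rw [gam_lint hf, gam_lint (f := fun x => f (T x)) (hf.comp hT),
    ← T.measurePreserving.lintegral_comp (f := fun x => ENNReal.ofReal (heatK 2 1 x) * f x) (heatK1_meas.mul hf)]
  refine lintegral_congr fun x => ?_
  simp [heatK_eq]

lemma heat_CK_pt {r ε : ℝ} (hr : 0 < r) (y ζ : E2) :
    heatK 2 1 ζ * heatK 2 r (y + ε • ζ) =
      heatK 2 (r + ε ^ 2) y * heatK 2 (r / (r + ε ^ 2)) (ζ - (-(ε / (r + ε ^ 2))) • y) := by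
  have h0 : 0 < r + ε ^ 2 := by positivity
  rw [heatK_eq, heatK_eq, heatK_eq, heatK_eq]
  have e1 : ‖y + ε • ζ‖ ^ 2 = ‖y‖ ^ 2 + 2 * ε * inner ℝ y ζ + ε ^ 2 * ‖ζ‖ ^ 2 := by
    rw [norm_add_sq_real, real_inner_smul_right, norm_smul, mul_pow, Real.norm_eq_abs, sq_abs]; ring
  have e2 : ‖ζ - (-(ε / (r + ε ^ 2))) • y‖ ^ 2 =
      ‖ζ‖ ^ 2 + 2 * (ε / (r + ε ^ 2)) * inner ℝ y ζ + (ε / (r + ε ^ 2)) ^ 2 * ‖y‖ ^ 2 := by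
    rw [neg_smul, sub_neg_eq_add, norm_add_sq_real, real_inner_smul_right, norm_smul, mul_pow,
      Real.norm_eq_abs, sq_abs, real_inner_comm]; ring
  have key : -‖ζ‖ ^ 2 / (2 * 1) + -‖y + ε • ζ‖ ^ 2 / (2 * r) =
      -‖y‖ ^ 2 / (2 * (r + ε ^ 2)) + -‖ζ - (-(ε / (r + ε ^ 2))) • y‖ ^ 2 / (2 * (r / (r + ε ^ 2))) := by
    rw [e1, e2]; field_simp; ring
  have key2 : (2 * π * 1)⁻¹ * (2 * π * r)⁻¹ = (2 * π * (r + ε ^ 2))⁻¹ * (2 * π * (r / (r + ε ^ 2)))⁻¹ := by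
    field_simp
  calc _ = ((2 * π * 1)⁻¹ * (2 * π * r)⁻¹) * (Real.exp (-‖ζ‖ ^ 2 / (2 * 1)) * Real.exp (-‖y + ε • ζ‖ ^ 2 / (2 * r))) := by ring
    _ = _ := by rw [← Real.exp_add, key, key2, Real.exp_add]; ring

lemma heat_CK {r ε : ℝ} (hr : 0 < r) (x v : E2) :
    ∫⁻ ζ, ENNReal.ofReal (heatK 2 r (x + ε • ζ - v)) ∂gam = ENNReal.ofReal (heatK 2 (r + ε ^ 2) (x - v)) := by
  have h0 : 0 < r + ε ^ 2 := by positivity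
  rw [gam_lint (by simp only [heatK_eq]; fun_prop)]
  have : ∀ ζ, ENNReal.ofReal (heatK 2 1 ζ) * ENNReal.ofReal (heatK 2 r (x + ε • ζ - v)) =
      ENNReal.ofReal (heatK 2 (r + ε ^ 2) (x - v)) *
       ENNReal.ofReal (heatK 2 (r / (r + ε ^ 2)) (ζ - (-(ε / (r + ε ^ 2))) • (x - v))) := by
    intro ζ
    rw [← ENNReal.ofReal_mul (heatK_pos one_pos _).le, ← ENNReal.ofReal_mul (heatK_pos h0 _).le,
      ← heat_CK_pt hr]
    congr 3; abel
  simp_rw [this]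
  rw [lintegral_const_mul _ (by simp only [heatK_eq]; fun_prop), heatK_lint (by positivity), mul_one]

lemma pHeatK_ofReal {r : ℝ} (hr : 0 < r) (x : E2) :
    ENNReal.ofReal (pHeatK 2 r x) = ∑' n : ZLat 2, ENNReal.ofReal (heatK 2 r (x - latVec n)) :=
  ENNReal.ofReal_tsum_of_nonneg (fun n => (heatK_pos hr _).le) (summ_heat hr x)

lemma pheat_CK {r ε : ℝ} (hr : 0 < r) (x : E2) :
    ∫⁻ ζ, ENNReal.ofReal (pHeatK 2 r (x + ε • ζ)) ∂gam = ENNReal.ofReal (pHeatK 2 (r + ε ^ 2) x) := by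
  simp_rw [pHeatK_ofReal hr]
  rw [lintegral_tsum (fun n => by simp only [heatK_eq]; fun_prop), pHeatK_ofReal (by positivity)]
  simp_rw [heat_CK hr]

lemma gam_norm : (2 : ENNReal) ≤ ∫⁻ ζ, ENNReal.ofReal (‖ζ‖ ^ 2) ∂gam := by
  have hk : ∀ l : ℝ, 0 < l → ENNReal.ofReal (2 / (1 + 2 * l)) ≤ ∫⁻ ζ, ENNReal.ofReal (‖ζ‖ ^ 2) ∂gam := by
    intro l hl
    have h1 : ∫⁻ ζ, ENNReal.ofReal (Real.exp (-l * ‖ζ‖ ^ 2)) ∂gam = ENNReal.ofReal (1 / (1 + 2 * l)) := by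
      have := heat_CK (r := 1 / (2 * l)) (ε := 1) (by positivity) 0 0
      simp only [heatK_eq, one_smul, zero_add, sub_zero, norm_zero] at this
      have h2 : ∀ ζ : E2, ENNReal.ofReal ((2 * π * (1 / (2 * l)))⁻¹ * Real.exp (-‖ζ‖ ^ 2 / (2 * (1 / (2 * l))))) =
          ENNReal.ofReal ((2 * π * (1 / (2 * l)))⁻¹) * ENNReal.ofReal (Real.exp (-l * ‖ζ‖ ^ 2)) := by
        intro ζ
        rw [ENNReal.ofReal_mul (by positivity)]
        congr 3; field_simp
      simp_rw [h2] at this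
      rw [lintegral_const_mul _ (by fun_prop)] at this
      have h3 : ENNReal.ofReal ((2 * π * (1 / (2 * l)))⁻¹) ≠ 0 := by
        simp only [ne_eq, ENNReal.ofReal_eq_zero, not_le]; positivity
      rw [← ENNReal.mul_right_inj h3 ENNReal.ofReal_ne_top, this, ← ENNReal.ofReal_mul (by positivity)]
      congr 1
      simp
      field_simp
      try ring
    have h4 : (1 : ENNReal) ≤ ENNReal.ofReal (1 / (1 + 2 * l)) + ENNReal.ofReal l * ∫⁻ ζ, ENNReal.ofReal (‖ζ‖ ^ 2) ∂gam := by
      rw [← h1, ← lintegral_const_mul _ (by fun_prop), ← lintegral_add_left (by fun_prop)]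
      calc (1 : ENNReal) = ∫⁻ ζ, 1 ∂gam := by simp
        _ ≤ _ := by
          refine lintegral_mono fun ζ => ?_
          rw [← ENNReal.ofReal_mul hl.le, ← ENNReal.ofReal_add (Real.exp_pos _).le (by positivity),
            ← ENNReal.ofReal_one]
          apply ENNReal.ofReal_le_ofReal
          have := Real.add_one_le_exp (-l * ‖ζ‖ ^ 2)
          linarith
    by_cases hI : (∫⁻ ζ, ENNReal.ofReal (‖ζ‖ ^ 2) ∂gam) = ⊤
    · rw [hI]; exact le_top
    rw [← ENNReal.ofReal_toReal hI]
    rw [← ENNReal.ofReal_toReal hI, ← ENNReal.ofReal_mul hl.le, ← ENNReal.ofReal_add (by positivity) (by positivity),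
      ← ENNReal.ofReal_one] at h4
    have h5 := (ENNReal.ofReal_le_ofReal_iff (by positivity)).1 h4
    apply ENNReal.ofReal_le_ofReal
    set I := (∫⁻ ζ, ENNReal.ofReal (‖ζ‖ ^ 2) ∂gam).toReal
    have e : 1 - 1 / (1 + 2 * l) = l * (2 / (1 + 2 * l)) := by field_simp; ring
    have : l * (2 / (1 + 2 * l)) ≤ l * I := by linarith
    exact le_of_mul_le_mul_left this hl
  have ht : Tendsto (fun l : ℝ => ENNReal.ofReal (2 / (1 + 2 * l))) (nhdsWithin 0 (Set.Ioi 0)) (nhds 2) := by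
    have : ContinuousAt (fun l : ℝ => ENNReal.ofReal (2 / (1 + 2 * l))) 0 := by
      apply ENNReal.continuous_ofReal.continuousAt.comp
      fun_prop (disch := norm_num)
    have h := this.tendsto.mono_left (nhdsWithin_le_nhds (s := Set.Ioi 0))
    simpa using h
  refine le_of_tendsto ht ?_
  filter_upwards [self_mem_nhdsWithin] with l hl using hk l hl

end Part2

section Part3

lemma Bell.convex {Φ : ℂ × ℂ → ℝ} (h : Bell Φ) : ConvexOn ℝ Set.univ Φ := by
  refine ⟨convex_univ, fun w₁ _ w₂ _ a b ha hb hab => ?_⟩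
  have := h.sc w₁ w₂ a b ha hb hab
  have h2 : 0 ≤ a * b * (‖w₁.1 - w₂.1‖ * ‖w₁.2 - w₂.2‖) := by positivity
  simp only [smul_eq_mul]
  linarith

lemma Bell.cont {Φ : ℂ × ℂ → ℝ} (h : Bell Φ) : Continuous Φ :=
  h.convex.locallyLipschitz.continuous

lemma Bell.sub_aff {Φ : ℂ × ℂ → ℝ} (h : Bell Φ) (l : ℂ × ℂ →L[ℝ] ℝ) (c : ℝ) (hl : ∀ w, l w + c ≤ Φ w) :
    Bell (fun w => Φ w - (l w + c)) := by
  refine ⟨fun w => sub_nonneg.2 (hl w), fun w₁ w₂ a b ha hb hab => ?_⟩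
  have := h.sc w₁ w₂ a b ha hb hab
  have h2 : c = a * c + b * c := by rw [← add_mul, hab, one_mul]
  simp only [map_add, map_smul, smul_eq_mul]
  linarith

lemma Bell.aff {Φ : ℂ × ℂ → ℝ} (h : Bell Φ) (w : ℂ × ℂ) (e : ℝ) (he : 0 < e) :
    ∃ (l : ℂ × ℂ →L[ℝ] ℝ) (c : ℝ), (∀ w, l w + c ≤ Φ w) ∧ l w + c = Φ w - e := by
  obtain ⟨l, c, h1, h2⟩ := ConvexOn.exists_affine_le_of_lt (𝕜 := ℝ) (x := w) (a := Φ w - e) (Set.mem_univ w)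
    (by linarith) isClosed_univ (h.cont.lowerSemicontinuous.lowerSemicontinuousOn _) h.convex
  refine ⟨l, c, fun w' => ?_, by simpa using h2⟩
  simpa using h1 ⟨w', Set.mem_univ _⟩

def rho (w₁ w₂ : ℂ × ℂ) : ℝ := ‖w₁.1 - w₂.1‖ * ‖w₁.2 - w₂.2‖

def wmean (N₁ N₂ : ℝ) (w₁ w₂ : ℂ × ℂ) : ℂ × ℂ := (N₁ / (N₁ + N₂)) • w₁ + (N₂ / (N₁ + N₂)) • w₂

lemma Bell.two {Θ : ℂ × ℂ → ℝ} (h : Bell Θ) {N₁ N₂ : ℝ} (h1 : 0 < N₁) (h2 : 0 < N₂) (w₁ w₂ : ℂ × ℂ) :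
    (N₁ + N₂) * Θ (wmean N₁ N₂ w₁ w₂) + N₁ * N₂ / (N₁ + N₂) * rho w₁ w₂ ≤ N₁ * Θ w₁ + N₂ * Θ w₂ := by
  have := h.sc w₁ w₂ (N₁ / (N₁ + N₂)) (N₂ / (N₁ + N₂)) (by positivity) (by positivity) (by field_simp)
  have h3 := mul_le_mul_of_nonneg_left this (add_pos h1 h2).le
  unfold wmean rho
  set X := ‖w₁.1 - w₂.1‖ * ‖w₁.2 - w₂.2‖
  have e1 : (N₁ + N₂) * (N₁ / (N₁ + N₂) * Θ w₁ + N₂ / (N₁ + N₂) * Θ w₂) = N₁ * Θ w₁ + N₂ * Θ w₂ := by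
    field_simp
  have e2 : (N₁ + N₂) * (N₁ / (N₁ + N₂) * (N₂ / (N₁ + N₂)) * X) = N₁ * N₂ / (N₁ + N₂) * X := by
    field_simp
  rw [mul_add, e2, e1] at h3
  exact h3

def Qg (N₁ N₂ N₃ N₄ : ℝ) (w₁ w₂ w₃ w₄ : ℂ × ℂ) : ℝ :=
  N₁ * N₂ / (N₁ + N₂) * rho w₁ w₂ + N₃ * N₄ / (N₃ + N₄) * rho w₃ w₄ +
    (N₁ + N₂) * (N₃ + N₄) / ((N₁ + N₂) + (N₃ + N₄)) * rho (wmean N₁ N₂ w₁ w₂) (wmean N₃ N₄ w₃ w₄)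

lemma Bell.four {Θ : ℂ × ℂ → ℝ} (h : Bell Θ) {N₁ N₂ N₃ N₄ : ℝ} (h1 : 0 < N₁) (h2 : 0 < N₂)
    (h3 : 0 < N₃) (h4 : 0 < N₄) (w₁ w₂ w₃ w₄ : ℂ × ℂ) :
    Qg N₁ N₂ N₃ N₄ w₁ w₂ w₃ w₄ ≤ N₁ * Θ w₁ + N₂ * Θ w₂ + (N₃ * Θ w₃ + N₄ * Θ w₄) := by
  have a := h.two h1 h2 w₁ w₂
  have b := h.two h3 h4 w₃ w₄
  have c := h.two (add_pos h1 h2) (add_pos h3 h4) (wmean N₁ N₂ w₁ w₂) (wmean N₃ N₄ w₃ w₄)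
  have d : 0 ≤ ((N₁ + N₂) + (N₃ + N₄)) * Θ (wmean (N₁ + N₂) (N₃ + N₄) (wmean N₁ N₂ w₁ w₂) (wmean N₃ N₄ w₃ w₄)) :=
    mul_nonneg (by positivity) (h.nonneg _)
  unfold Qg
  linarith



lemma rho_smul (c : ℝ) (w₁ w₂ w₀ : ℂ × ℂ) : c ^ 2 * rho w₁ w₂ = rho (c • (w₁ - w₀)) (c • (w₂ - w₀)) := by
  unfold rho
  have e1 : (c • (w₁ - w₀)).1 - (c • (w₂ - w₀)).1 = c • (w₁.1 - w₂.1) := by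
    simp only [Prod.smul_fst, Prod.fst_sub, ← smul_sub]; congr 1; abel
  have e2 : (c • (w₁ - w₀)).2 - (c • (w₂ - w₀)).2 = c • (w₁.2 - w₂.2) := by
    simp only [Prod.smul_snd, Prod.snd_sub, ← smul_sub]; congr 1; abel
  rw [e1, e2, norm_smul, norm_smul, ← sq_abs, Real.norm_eq_abs]; ring

lemma wmean_smul (c N₁ N₂ : ℝ) (h1 : 0 < N₁) (h2 : 0 < N₂) (w₁ w₂ w₀ : ℂ × ℂ) :
    c • (wmean N₁ N₂ w₁ w₂ - w₀) = wmean N₁ N₂ (c • (w₁ - w₀)) (c • (w₂ - w₀)) := by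
  unfold wmean
  have e : w₀ = (N₁ / (N₁ + N₂)) • w₀ + (N₂ / (N₁ + N₂)) • w₀ := by
    rw [← add_smul, ← add_div, div_self (by positivity), one_smul]
  nth_rewrite 1 [e]
  rw [smul_comm _ c, smul_comm _ c, ← smul_add, add_sub_add_comm, ← smul_sub, ← smul_sub]

lemma rho_cont : Continuous fun z : (ℂ × ℂ) × (ℂ × ℂ) => rho z.1 z.2 := by
  unfold rho; fun_prop

lemma wmean_lim {N₁ N₂ : ℕ → ℝ} {w₁ w₂ : ℕ → ℂ × ℂ} {N : ℝ} (hN : 0 < N) {d₁ d₂ : ℂ × ℂ}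
    (h1 : Tendsto N₁ atTop (nhds N)) (h2 : Tendsto N₂ atTop (nhds N))
    (k1 : Tendsto w₁ atTop (nhds d₁)) (k2 : Tendsto w₂ atTop (nhds d₂)) :
    Tendsto (fun n => wmean (N₁ n) (N₂ n) (w₁ n) (w₂ n)) atTop (nhds ((1 / 2 : ℝ) • (d₁ + d₂))) := by
  have e : (1 / 2 : ℝ) • (d₁ + d₂) = (N / (N + N)) • d₁ + (N / (N + N)) • d₂ := by
    rw [← smul_add]; congr 1; field_simp; norm_num
  rw [e]
  exact ((h1.div (h1.add h2) (by positivity)).smul k1).add ((h2.div (h1.add h2) (by positivity)).smul k2)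

lemma rho_lim {a b : ℕ → ℂ × ℂ} {x y : ℂ × ℂ} (ha : Tendsto a atTop (nhds x))
    (hb : Tendsto b atTop (nhds y)) :
    Tendsto (fun n => rho (a n) (b n)) atTop (nhds (rho x y)) := by
  have h1 : Tendsto (fun n => ‖(a n).1 - (b n).1‖) atTop (nhds ‖x.1 - y.1‖) :=
    (((continuous_fst.tendsto x).comp ha).sub ((continuous_fst.tendsto y).comp hb)).norm
  have h2 : Tendsto (fun n => ‖(a n).2 - (b n).2‖) atTop (nhds ‖x.2 - y.2‖) :=
    (((continuous_snd.tendsto x).comp ha).sub ((continuous_snd.tendsto y).comp hb)).norm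
  exact h1.mul h2

lemma coef_lim {a b : ℕ → ℝ} {A B : ℝ} (h : 0 < A + B) (ha : Tendsto a atTop (nhds A))
    (hb : Tendsto b atTop (nhds B)) :
    Tendsto (fun n => a n * b n / (a n + b n)) atTop (nhds (A * B / (A + B))) :=
  (ha.mul hb).div (ha.add hb) h.ne'

lemma Qg_lim {c N₁ N₂ N₃ N₄ : ℕ → ℝ} {w₁ w₂ w₃ w₄ : ℕ → ℂ × ℂ} {w₀ : ℂ × ℂ} {N : ℝ} (hN : 0 < N)
    {d₁ d₂ d₃ d₄ : ℂ × ℂ}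
    (p1 : ∀ n, 0 < N₁ n) (p2 : ∀ n, 0 < N₂ n) (p3 : ∀ n, 0 < N₃ n) (p4 : ∀ n, 0 < N₄ n)
    (h1 : Tendsto N₁ atTop (nhds N)) (h2 : Tendsto N₂ atTop (nhds N))
    (h3 : Tendsto N₃ atTop (nhds N)) (h4 : Tendsto N₄ atTop (nhds N))
    (k1 : Tendsto (fun n => c n • (w₁ n - w₀)) atTop (nhds d₁))
    (k2 : Tendsto (fun n => c n • (w₂ n - w₀)) atTop (nhds d₂))
    (k3 : Tendsto (fun n => c n • (w₃ n - w₀)) atTop (nhds d₃))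
    (k4 : Tendsto (fun n => c n • (w₄ n - w₀)) atTop (nhds d₄)) :
    Tendsto (fun n => c n ^ 2 * Qg (N₁ n) (N₂ n) (N₃ n) (N₄ n) (w₁ n) (w₂ n) (w₃ n) (w₄ n)) atTop
      (nhds (N / 2 * rho d₁ d₂ + N / 2 * rho d₃ d₄ + N * rho ((1 / 2 : ℝ) • (d₁ + d₂)) ((1 / 2 : ℝ) • (d₃ + d₄)))) := by
  have e : ∀ n, c n ^ 2 * Qg (N₁ n) (N₂ n) (N₃ n) (N₄ n) (w₁ n) (w₂ n) (w₃ n) (w₄ n) =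
      N₁ n * N₂ n / (N₁ n + N₂ n) * rho (c n • (w₁ n - w₀)) (c n • (w₂ n - w₀)) +
      N₃ n * N₄ n / (N₃ n + N₄ n) * rho (c n • (w₃ n - w₀)) (c n • (w₄ n - w₀)) +
      (N₁ n + N₂ n) * (N₃ n + N₄ n) / ((N₁ n + N₂ n) + (N₃ n + N₄ n)) *
        rho (wmean (N₁ n) (N₂ n) (c n • (w₁ n - w₀)) (c n • (w₂ n - w₀)))
          (wmean (N₃ n) (N₄ n) (c n • (w₃ n - w₀)) (c n • (w₄ n - w₀))) := by
    intro n
    rw [← wmean_smul _ _ _ (p1 n) (p2 n), ← wmean_smul _ _ _ (p3 n) (p4 n), ← rho_smul, ← rho_smul, ← rho_smul]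
    unfold Qg
    ring
  rw [funext e]
  have t1 : N * N / (N + N) = N / 2 := by field_simp; norm_num
  have t2 : (N + N) * (N + N) / ((N + N) + (N + N)) = N := by field_simp
  have c1 := coef_lim (by positivity) h1 h2
  have c2 := coef_lim (by positivity) h3 h4
  have c3 := coef_lim (by positivity) (h1.add h2) (h3.add h4)
  rw [t1] at c1 c2
  rw [t2] at c3
  exact ((c1.mul (rho_lim k1 k2)).add (c2.mul (rho_lim k3 k4))).add
    (c3.mul (rho_lim (wmean_lim hN h1 h2 k1 k2) (wmean_lim hN h3 h4 k3 k4)))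

/-! ### the functions u, v -/

def hh (m : ZLat 2) (s : ℝ) (x : E2) : ℝ := heatK 2 s (x - latVec m) / pHeatK 2 s x

def uu (F : Finset (ZLat 2)) (f : ZLat 2 → ℂ) (s : ℝ) (x : E2) : ℂ := ∑ m ∈ F, hh m s x • f m

def ww (F : Finset (ZLat 2)) (f g : ZLat 2 → ℂ) (s : ℝ) (x : E2) : ℂ × ℂ := (uu F f s x, uu F g s x)

def GG (Φ : ℂ × ℂ → ℝ) (F : Finset (ZLat 2)) (f g : ZLat 2 → ℂ) (s : ℝ) (x : E2) : ℝ :=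
  pHeatK 2 s x * Φ (ww F f g s x)

lemma ww_eq (F : Finset (ZLat 2)) (f g : ZLat 2 → ℂ) (s : ℝ) (x : E2) :
    ww F f g s x = ∑ m ∈ F, hh m s x • (f m, g m) := by
  unfold ww uu
  ext1
  · simp [Prod.fst_sum]
  · simp [Prod.snd_sum]

lemma hh_nonneg {s : ℝ} (hs : 0 < s) (m : ZLat 2) (x : E2) : 0 ≤ hh m s x :=
  div_nonneg (heatK_pos hs _).le (pHeatK_pos hs _).le

lemma pH_hh {s : ℝ} (hs : 0 < s) (m : ZLat 2) (x : E2) : pHeatK 2 s x * hh m s x = heatK 2 s (x - latVec m) := by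
  unfold hh
  have := pHeatK_pos hs x
  field_simp

lemma hh_sum {s : ℝ} (hs : 0 < s) (F : Finset (ZLat 2)) (x : E2) : ∑ m ∈ F, hh m s x ≤ 1 := by
  unfold hh
  rw [← Finset.sum_div, div_le_one (pHeatK_pos hs x)]
  exact (summ_heat hs x).sum_le_tsum F (fun n _ => (heatK_pos hs _).le)

lemma hh_diff {s : ℝ} (hs : 0 < s) (m : ZLat 2) : Differentiable ℝ (hh m s) := by
  intro x
  unfold hh
  simp only [div_eq_mul_inv]
  exact ((heatK_hasFDerivAt s _ x).differentiableAt).fun_mul ((pHeatK_diff hs x).fun_inv (pHeatK_pos hs x).ne')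

lemma uu_diff {s : ℝ} (hs : 0 < s) (F : Finset (ZLat 2)) (f : ZLat 2 → ℂ) : Differentiable ℝ (uu F f s) := by
  unfold uu
  have := fun m => hh_diff hs m
  fun_prop

lemma ww_diff {s : ℝ} (hs : 0 < s) (F : Finset (ZLat 2)) (f g : ZLat 2 → ℂ) : Differentiable ℝ (ww F f g s) :=
  (uu_diff hs F f).prodMk (uu_diff hs F g)

lemma hh_meas (m : ZLat 2) : Measurable fun z : ℝ × E2 => hh m z.1 z.2 :=
  (heatK_meas _).div pHeatK_meas

lemma uu_meas (F : Finset (ZLat 2)) (f : ZLat 2 → ℂ) : Measurable fun z : ℝ × E2 => uu F f z.1 z.2 := by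
  unfold uu
  exact Finset.measurable_fun_sum _ fun m _ => (hh_meas m).smul_const _

lemma GG_meas {Φ : ℂ × ℂ → ℝ} (h : Bell Φ) (F : Finset (ZLat 2)) (f g : ZLat 2 → ℂ) :
    Measurable fun z : ℝ × E2 => GG Φ F f g z.1 z.2 :=
  pHeatK_meas.mul (h.cont.measurable.comp ((uu_meas F f).prodMk (uu_meas F g)))

lemma GG_nonneg {Φ : ℂ × ℂ → ℝ} (h : Bell Φ) (F : Finset (ZLat 2)) (f g : ZLat 2 → ℂ) {s : ℝ} (hs : 0 < s)
    (x : E2) : 0 ≤ GG Φ F f g s x := mul_nonneg (pHeatK_pos hs x).le (h.nonneg _)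

lemma GG_le {Φ : ℂ × ℂ → ℝ} (h : Bell Φ) (h0 : Φ 0 = 0) (F : Finset (ZLat 2)) (f g : ZLat 2 → ℂ) {s : ℝ} (hs : 0 < s)
    (x : E2) : GG Φ F f g s x ≤ ∑ m ∈ F, heatK 2 s (x - latVec m) * Φ (f m, g m) := by
  have := h.convex.map_add_sum_le (t := F) (w := fun m => hh m s x) (p := fun m => (f m, g m))
    (q := 0) (v := 1 - ∑ m ∈ F, hh m s x) (fun m _ => hh_nonneg hs m x) (by ring) (fun _ _ => Set.mem_univ _)
    (by linarith [hh_sum hs F x]) (Set.mem_univ _)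
  rw [smul_zero, zero_add, ← ww_eq, h0, smul_zero, zero_add] at this
  unfold GG
  refine (mul_le_mul_of_nonneg_left this (pHeatK_pos hs x).le).trans_eq ?_
  rw [Finset.mul_sum]
  refine Finset.sum_congr rfl fun m _ => ?_
  rw [smul_eq_mul, ← mul_assoc, pH_hh hs]

lemma heat_gam {r : ℝ} (ε : ℝ) (hr : 0 < r) (x v : E2) :
    Integrable (fun ζ => heatK 2 r (x + ε • ζ - v)) gam ∧
      ∫ ζ, heatK 2 r (x + ε • ζ - v) ∂gam = heatK 2 (r + ε ^ 2) (x - v) := by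
  have hm : Measurable fun ζ : E2 => heatK 2 r (x + ε • ζ - v) := by simp only [heatK_eq]; fun_prop
  have hn : ∀ ζ : E2, 0 ≤ heatK 2 r (x + ε • ζ - v) := fun ζ => (heatK_pos hr _).le
  constructor
  · refine ⟨hm.aestronglyMeasurable, ?_⟩
    rw [hasFiniteIntegral_iff_ofReal (ae_of_all _ hn), heat_CK hr]
    exact ENNReal.ofReal_lt_top
  · rw [integral_eq_lintegral_of_nonneg_ae (ae_of_all _ hn) hm.aestronglyMeasurable, heat_CK hr,
      ENNReal.toReal_ofReal (heatK_pos (by positivity) _).le]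

lemma pheat_gam {r : ℝ} (ε : ℝ) (hr : 0 < r) (x : E2) :
    Integrable (fun ζ => pHeatK 2 r (x + ε • ζ)) gam ∧
      ∫ ζ, pHeatK 2 r (x + ε • ζ) ∂gam = pHeatK 2 (r + ε ^ 2) x := by
  have hm : Measurable fun ζ : E2 => pHeatK 2 r (x + ε • ζ) :=
    (pHeatK_diff hr).continuous.measurable.comp (by fun_prop)
  have hn : ∀ ζ : E2, 0 ≤ pHeatK 2 r (x + ε • ζ) := fun ζ => (pHeatK_pos hr _).le
  constructor
  · refine ⟨hm.aestronglyMeasurable, ?_⟩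
    rw [hasFiniteIntegral_iff_ofReal (ae_of_all _ hn), pheat_CK hr]
    exact ENNReal.ofReal_lt_top
  · rw [integral_eq_lintegral_of_nonneg_ae (ae_of_all _ hn) hm.aestronglyMeasurable, pheat_CK hr,
      ENNReal.toReal_ofReal (pHeatK_pos (by positivity) _).le]

lemma GG_gam {Φ : ℂ × ℂ → ℝ} (h : Bell Φ) (h0 : Φ 0 = 0) (F : Finset (ZLat 2)) (f g : ZLat 2 → ℂ) {r : ℝ}
    (ε : ℝ) (hr : 0 < r) (x : E2) : Integrable (fun ζ => GG Φ F f g r (x + ε • ζ)) gam := by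
  have hm : Measurable fun ζ : E2 => GG Φ F f g r (x + ε • ζ) :=
    (GG_meas h F f g).comp (measurable_const.prodMk (by fun_prop))
  refine Integrable.mono' (g := fun ζ => ∑ m ∈ F, heatK 2 r (x + ε • ζ - latVec m) * Φ (f m, g m)) ?_
    hm.aestronglyMeasurable (ae_of_all _ fun ζ => ?_)
  · exact integrable_finsetSum _ fun m _ => (heat_gam ε hr x _).1.mul_const _
  · rw [Real.norm_of_nonneg (GG_nonneg h F f g hr _)]
    exact GG_le h h0 F f g hr _

lemma theta_gam {Φ : ℂ × ℂ → ℝ} (h : Bell Φ) (h0 : Φ 0 = 0) (F : Finset (ZLat 2)) (f g : ZLat 2 → ℂ) {r : ℝ}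
    (ε : ℝ) (hr : 0 < r) (x : E2) (l : ℂ × ℂ →L[ℝ] ℝ) (c : ℝ) :
    Integrable (fun ζ => GG (fun w => Φ w - (l w + c)) F f g r (x + ε • ζ)) gam ∧
    ∫ ζ, GG (fun w => Φ w - (l w + c)) F f g r (x + ε • ζ) ∂gam =
      (∫ ζ, GG Φ F f g r (x + ε • ζ) ∂gam) -
        pHeatK 2 (r + ε ^ 2) x * (l (ww F f g (r + ε ^ 2) x) + c) := by
  have e : ∀ s, 0 < s → ∀ y, pHeatK 2 s y * (l (ww F f g s y) + c) =
      (∑ m ∈ F, heatK 2 s (y - latVec m) * l (f m, g m)) + c * pHeatK 2 s y := by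
    intro s hs y
    rw [ww_eq, map_sum, mul_add, Finset.mul_sum, mul_comm _ c]
    congr 1
    refine Finset.sum_congr rfl fun m _ => ?_
    rw [map_smul, smul_eq_mul, ← mul_assoc, pH_hh hs]
  have e2 : ∀ ζ, GG (fun w => Φ w - (l w + c)) F f g r (x + ε • ζ) = GG Φ F f g r (x + ε • ζ) -
      ((∑ m ∈ F, heatK 2 r (x + ε • ζ - latVec m) * l (f m, g m)) + c * pHeatK 2 r (x + ε • ζ)) := by
    intro ζ
    rw [← e r hr]; unfold GG; ring
  have i1 := GG_gam h h0 F f g ε hr x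
  have i2 : ∀ m ∈ F, Integrable (fun ζ => heatK 2 r (x + ε • ζ - latVec m) * l (f m, g m)) gam :=
    fun m _ => (heat_gam ε hr x (latVec m)).1.mul_const _
  have i2' := integrable_finsetSum F i2
  have i3 : Integrable (fun ζ => c * pHeatK 2 r (x + ε • ζ)) gam := (pheat_gam ε hr x).1.const_mul c
  have i4 : Integrable (fun ζ => (∑ m ∈ F, heatK 2 r (x + ε • ζ - latVec m) * l (f m, g m)) +
      c * pHeatK 2 r (x + ε • ζ)) gam := i2'.add i3
  simp_rw [e2]
  refine ⟨i1.sub i4, ?_⟩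
  rw [integral_sub i1 i4, integral_add i2' i3, integral_finsetSum F i2, integral_const_mul,
    (pheat_gam ε hr x).2, e _ (by positivity)]
  congr 2
  refine Finset.sum_congr rfl fun m _ => ?_
  rw [integral_mul_const, (heat_gam ε hr x _).2]

end Part3

section Part4

lemma Qg_meas {N₁ N₂ N₃ N₄ : E2 → ℝ} {w₁ w₂ w₃ w₄ : E2 → ℂ × ℂ} (h1 : Measurable N₁) (h2 : Measurable N₂)
    (h3 : Measurable N₃) (h4 : Measurable N₄) (k1 : Measurable w₁) (k2 : Measurable w₂)
    (k3 : Measurable w₃) (k4 : Measurable w₄) :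
    Measurable fun ζ => Qg (N₁ ζ) (N₂ ζ) (N₃ ζ) (N₄ ζ) (w₁ ζ) (w₂ ζ) (w₃ ζ) (w₄ ζ) := by
  unfold Qg rho wmean
  fun_prop

def gainF (F : Finset (ZLat 2)) (f g : ZLat 2 → ℂ) (r : ℝ) (x : E2) (ε : ℝ) (T : E2 ≃ₗᵢ[ℝ] E2) (ζ : E2) : ℝ :=
  (1 / 4) * Qg (pHeatK 2 r (x + ε • ζ)) (pHeatK 2 r (x + ε • (-T ζ))) (pHeatK 2 r (x + ε • (T ζ)))
    (pHeatK 2 r (x + ε • (-ζ)))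
    (ww F f g r (x + ε • ζ)) (ww F f g r (x + ε • (-T ζ))) (ww F f g r (x + ε • (T ζ)))
    (ww F f g r (x + ε • (-ζ)))

lemma gainF_meas (F : Finset (ZLat 2)) (f g : ZLat 2 → ℂ) {r : ℝ} (hr : 0 < r) (x : E2) (ε : ℝ) (T : E2 ≃ₗᵢ[ℝ] E2) :
    Measurable (gainF F f g r x ε T) := by
  have h1 : Measurable (pHeatK 2 r) := (pHeatK_diff hr).continuous.measurable
  have h2 : Measurable (ww F f g r) := (ww_diff hr F f g).continuous.measurable
  have hT : Measurable T := T.continuous.measurable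
  unfold gainF
  refine (Qg_meas ?_ ?_ ?_ ?_ ?_ ?_ ?_ ?_).const_mul _
  · exact h1.comp (by fun_prop)
  · exact h1.comp (by fun_prop)
  · exact h1.comp (by fun_prop)
  · exact h1.comp (by fun_prop)
  · exact h2.comp (by fun_prop)
  · exact h2.comp (by fun_prop)
  · exact h2.comp (by fun_prop)
  · exact h2.comp (by fun_prop)

lemma gain_le {Φ : ℂ × ℂ → ℝ} (h : Bell Φ) (h0 : Φ 0 = 0) (F : Finset (ZLat 2)) (f g : ZLat 2 → ℂ) {r : ℝ}
    (ε : ℝ) (hr : 0 < r) (x : E2) (T : E2 ≃ₗᵢ[ℝ] E2) :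
    GG Φ F f g (r + ε ^ 2) x ≤ ∫ ζ, GG Φ F f g r (x + ε • ζ) ∂gam ∧
    ∫⁻ ζ, ENNReal.ofReal (gainF F f g r x ε T ζ) ∂gam ≤
      ENNReal.ofReal ((∫ ζ, GG Φ F f g r (x + ε • ζ) ∂gam) - GG Φ F f g (r + ε ^ 2) x) := by
  set A := ∫ ζ, GG Φ F f g r (x + ε • ζ) ∂gam
  set B := GG Φ F f g (r + ε ^ 2) x with hB
  set H' := pHeatK 2 (r + ε ^ 2) x with hH'
  have key : ∀ e : ℝ, 0 < e → 0 ≤ A - B + H' * e ∧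
      ∫⁻ ζ, ENNReal.ofReal (gainF F f g r x ε T ζ) ∂gam ≤ ENNReal.ofReal (A - B + H' * e) := by
    intro e he
    obtain ⟨l, c, hl, hlc⟩ := h.aff (ww F f g (r + ε ^ 2) x) e he
    have hΘ := h.sub_aff l c hl
    obtain ⟨i, ei⟩ := theta_gam h h0 F f g ε hr x l c
    set Θ := fun w => Φ w - (l w + c)
    have e1 : ∫ ζ, GG Θ F f g r (x + ε • ζ) ∂gam = A - B + H' * e := by
      rw [ei, hlc]
      show A - H' * (Φ (ww F f g (r + ε ^ 2) x) - e) = A - H' * Φ (ww F f g (r + ε ^ 2) x) + H' * e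
      ring
    have hn : ∀ ζ, 0 ≤ GG Θ F f g r (x + ε • ζ) := fun ζ => GG_nonneg hΘ F f g hr _
    refine ⟨by rw [← e1]; exact integral_nonneg hn, ?_⟩
    have hm : Measurable fun ζ : E2 => ENNReal.ofReal (GG Θ F f g r (x + ε • ζ)) :=
      ((GG_meas hΘ F f g).comp (measurable_const.prodMk (by fun_prop))).ennreal_ofReal
    rw [← e1, ofReal_integral_eq_lintegral_ofReal i (ae_of_all _ hn)]
    set J := ∫⁻ ζ, ENNReal.ofReal (GG Θ F f g r (x + ε • ζ)) ∂gam
    let Tn : E2 ≃ₗᵢ[ℝ] E2 := T.trans (LinearIsometryEquiv.neg ℝ)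
    have j2 : ∫⁻ ζ, ENNReal.ofReal (GG Θ F f g r (x + ε • (-T ζ))) ∂gam = J := gam_iso Tn hm
    have j3 : ∫⁻ ζ, ENNReal.ofReal (GG Θ F f g r (x + ε • (T ζ))) ∂gam = J := gam_iso T hm
    have j4 : ∫⁻ ζ, ENNReal.ofReal (GG Θ F f g r (x + ε • (-ζ))) ∂gam = J :=
      gam_iso (LinearIsometryEquiv.neg ℝ) hm
    have m2 := hm.comp Tn.continuous.measurable
    have m3 := hm.comp T.continuous.measurable
    have m4 := hm.comp (LinearIsometryEquiv.neg ℝ (E := E2)).continuous.measurable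
    calc ∫⁻ ζ, ENNReal.ofReal (gainF F f g r x ε T ζ) ∂gam
        ≤ ∫⁻ ζ, ENNReal.ofReal (1 / 4) * (ENNReal.ofReal (GG Θ F f g r (x + ε • ζ)) +
          ENNReal.ofReal (GG Θ F f g r (x + ε • (-T ζ))) + ENNReal.ofReal (GG Θ F f g r (x + ε • (T ζ))) +
          ENNReal.ofReal (GG Θ F f g r (x + ε • (-ζ)))) ∂gam := by
          refine lintegral_mono fun ζ => ?_
          rw [← ENNReal.ofReal_add (hn _) (hn _), ← ENNReal.ofReal_add (add_nonneg (hn _) (hn _)) (hn _),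
            ← ENNReal.ofReal_add (add_nonneg (add_nonneg (hn _) (hn _)) (hn _)) (hn _),
            ← ENNReal.ofReal_mul (by norm_num)]
          apply ENNReal.ofReal_le_ofReal
          unfold gainF
          refine mul_le_mul_of_nonneg_left ?_ (by norm_num)
          refine (hΘ.four (pHeatK_pos hr _) (pHeatK_pos hr _) (pHeatK_pos hr _) (pHeatK_pos hr _) _ _ _ _).trans_eq ?_
          unfold GG
          ring
      _ = ENNReal.ofReal (1 / 4) * (J + J + J + J) := by
          rw [lintegral_const_mul, lintegral_add_left, lintegral_add_left, lintegral_add_left hm, j2, j3, j4]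
          · exact hm.add m2
          · exact (hm.add m2).add m3
          · exact ((hm.add m2).add m3).add m4
      _ = J := by
          rw [show J + J + J + J = 4 * J by ring, ← mul_assoc,
            show (4 : ENNReal) = ENNReal.ofReal 4 by norm_num, ← ENNReal.ofReal_mul (by norm_num)]
          norm_num
  have hH : 0 < H' := pHeatK_pos (by positivity) x
  have hlim : Tendsto (fun e : ℝ => A - B + H' * e) (nhdsWithin 0 (Set.Ioi 0)) (nhds (A - B)) := by
    have : ContinuousAt (fun e : ℝ => A - B + H' * e) 0 := by fun_prop
    have := this.tendsto.mono_left (nhdsWithin_le_nhds (s := Set.Ioi 0))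
    simpa using this
  constructor
  · have : 0 ≤ A - B := ge_of_tendsto hlim (by filter_upwards [self_mem_nhdsWithin] with e he using (key e he).1)
    linarith
  · exact ge_of_tendsto ((ENNReal.continuous_ofReal.tendsto _).comp hlim)
      (by filter_upwards [self_mem_nhdsWithin] with e he using (key e he).2)

def evec (c s : ℝ) : E2 := !₂[c, s]

lemma evec_norm {c s : ℝ} (h : c ^ 2 + s ^ 2 = 1) : ‖evec c s‖ = 1 := by
  rw [EuclideanSpace.norm_eq]; simp [evec, h]

lemma evec_inner (c s : ℝ) (ζ : E2) : inner ℝ (evec c s) ζ = c * ζ 0 + s * ζ 1 := by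
  simp [evec, PiLp.inner_apply, Fin.sum_univ_two]; ring

lemma evec_exp {c s : ℝ} (h : c ^ 2 + s ^ 2 = 1) (ζ : E2) :
    ζ = (inner ℝ (evec c s) ζ : ℝ) • evec c s + (inner ℝ (evec (-s) c) ζ : ℝ) • evec (-s) c := by
  rw [evec_inner, evec_inner]
  ext i
  fin_cases i
  · simp [evec]; linear_combination (-ζ 0) * h
  · simp [evec]; linear_combination (-ζ 1) * h

lemma evec_normsq {c s : ℝ} (h : c ^ 2 + s ^ 2 = 1) (ζ : E2) :
    ‖ζ‖ ^ 2 = (inner ℝ (evec c s) ζ : ℝ) ^ 2 + (inner ℝ (evec (-s) c) ζ : ℝ) ^ 2 := by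
  rw [evec_inner, evec_inner, EuclideanSpace.norm_sq_eq, Fin.sum_univ_two]
  simp only [Real.norm_eq_abs, sq_abs]
  linear_combination (-(ζ 0) ^ 2 - (ζ 1) ^ 2) * h

lemma refl_eq {c s : ℝ} (h : c ^ 2 + s ^ 2 = 1) (ζ : E2) :
    Submodule.reflection (ℝ ∙ (evec c s)) ζ = (2 * (inner ℝ (evec c s) ζ : ℝ)) • evec c s - ζ := by
  rw [Submodule.reflection_singleton_apply, evec_norm h]
  simp [two_smul, two_mul, add_smul]

lemma evec_moment {c s : ℝ} (h : c ^ 2 + s ^ 2 = 1) :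
    1 ≤ ∫⁻ ζ, ENNReal.ofReal ((inner ℝ (evec c s) ζ : ℝ) ^ 2) ∂gam := by
  -- rotation by reflection in the line (e + e')
  have hm : ∀ v : E2, Measurable fun ζ : E2 => ENNReal.ofReal ((inner ℝ v ζ : ℝ) ^ 2) := by
    intro v; fun_prop
  set k := (√2)⁻¹
  have hk : k ^ 2 = 1 / 2 := by simp [k]
  have h' : (k * (c - s)) ^ 2 + (k * (s + c)) ^ 2 = 1 := by
    linear_combination (2 * (c ^ 2 + s ^ 2)) * hk + h
  have h1 := gam_iso (Submodule.reflection (ℝ ∙ (evec (k * (c - s)) (k * (s + c))))) (hm (evec c s))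
  have h2 : ∀ ζ, inner ℝ (evec c s) (Submodule.reflection (ℝ ∙ (evec (k * (c - s)) (k * (s + c)))) ζ) =
      inner ℝ (evec (-s) c) ζ := by
    intro ζ
    rw [refl_eq h', inner_sub_right, inner_smul_right, evec_inner, evec_inner, evec_inner, evec_inner]
    simp only [evec, Fin.isValue, PiLp.toLp_apply, Matrix.cons_val_zero, Matrix.cons_val_one]
    linear_combination (2 * (ζ 0 * (c - s) + ζ 1 * (s + c)) * (c ^ 2 + s ^ 2)) * hk + (ζ 0 * (c - s) + ζ 1 * (s + c)) * h
  simp_rw [h2] at h1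
  have h3 := gam_norm
  simp_rw [evec_normsq h] at h3
  have h4 : ∀ ζ : E2, ENNReal.ofReal ((inner ℝ (evec c s) ζ : ℝ) ^ 2 + (inner ℝ (evec (-s) c) ζ : ℝ) ^ 2) =
      ENNReal.ofReal ((inner ℝ (evec c s) ζ : ℝ) ^ 2) + ENNReal.ofReal ((inner ℝ (evec (-s) c) ζ : ℝ) ^ 2) :=
    fun ζ => ENNReal.ofReal_add (sq_nonneg _) (sq_nonneg _)
  simp_rw [h4] at h3
  rw [lintegral_add_left (hm _), h1, ← two_mul] at h3
  have h5 : (2 : ENNReal) * 1 ≤ 2 * ∫⁻ ζ, ENNReal.ofReal ((inner ℝ (evec c s) ζ : ℝ) ^ 2) ∂gam := by simpa using h3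
  exact (ENNReal.mul_le_mul_iff_right (by norm_num) (by norm_num)).1 h5

lemma gain_lim (F : Finset (ZLat 2)) (f g : ZLat 2 → ℂ) {r : ℝ} (hr : 0 < r) (x : E2) {c s : ℝ}
    (h : c ^ 2 + s ^ 2 = 1) (ζ : E2) :
    Tendsto (fun n : ℕ => ((n : ℝ) + 1) ^ 2 *
      gainF F f g r x ((n : ℝ) + 1)⁻¹ (Submodule.reflection (ℝ ∙ (evec c s))) ζ) atTop
      (nhds (pHeatK 2 r x * (‖fderiv ℝ (uu F f r) x (evec c s)‖ * ‖fderiv ℝ (uu F g r) x (evec c s)‖) *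
          (inner ℝ (evec c s) ζ : ℝ) ^ 2 +
        pHeatK 2 r x * (‖fderiv ℝ (uu F f r) x (evec (-s) c)‖ * ‖fderiv ℝ (uu F g r) x (evec (-s) c)‖) *
          (inner ℝ (evec (-s) c) ζ : ℝ) ^ 2)) := by
  set T := Submodule.reflection (ℝ ∙ (evec c s)) with hT
  have hc : Tendsto (fun n : ℕ => (n : ℝ) + 1) atTop atTop :=
    tendsto_atTop_add_const_right _ _ tendsto_natCast_atTop_atTop
  have hN : ∀ v : E2, Tendsto (fun n : ℕ => pHeatK 2 r (x + ((n : ℝ) + 1)⁻¹ • v)) atTop (nhds (pHeatK 2 r x)) := by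
    intro v
    have h1 : Tendsto (fun n : ℕ => x + ((n : ℝ) + 1)⁻¹ • v) atTop (nhds (x + (0 : ℝ) • v)) :=
      tendsto_const_nhds.add ((tendsto_inv_atTop_zero.comp hc).smul_const v)
    rw [zero_smul, add_zero] at h1
    exact ((pHeatK_diff hr).continuous.tendsto x).comp h1
  set Du := fderiv ℝ (uu F f r) x
  set Dv := fderiv ℝ (uu F g r) x
  have hd : HasFDerivAt (ww F f g r) (Du.prod Dv) x :=
    (uu_diff hr F f x).hasFDerivAt.prodMk (uu_diff hr F g x).hasFDerivAt
  have hW : ∀ v : E2, Tendsto (fun n : ℕ => ((n : ℝ) + 1) • (ww F f g r (x + ((n : ℝ) + 1)⁻¹ • v) - ww F f g r x))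
      atTop (nhds ((Du.prod Dv) v)) := by
    intro v
    exact (hd.lim_real v).comp hc
  have key := Qg_lim (pHeatK_pos hr x) (fun n => pHeatK_pos hr _) (fun n => pHeatK_pos hr _)
    (fun n => pHeatK_pos hr _) (fun n => pHeatK_pos hr _) (hN ζ) (hN (-T ζ)) (hN (T ζ)) (hN (-ζ))
    (hW ζ) (hW (-T ζ)) (hW (T ζ)) (hW (-ζ))
  have key2 := key.const_mul (1 / 4)
  have e1 : ζ - -T ζ = (2 * (inner ℝ (evec c s) ζ : ℝ)) • evec c s := by rw [hT, refl_eq h]; abel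
  have e2 : T ζ - -ζ = (2 * (inner ℝ (evec c s) ζ : ℝ)) • evec c s := by rw [hT, refl_eq h]; abel
  have e3 : (1 / 2 : ℝ) • (ζ + -T ζ) = (inner ℝ (evec (-s) c) ζ : ℝ) • evec (-s) c := by
    rw [hT, refl_eq h]
    nth_rewrite 1 [evec_exp h ζ]; nth_rewrite 4 [evec_exp h ζ]
    module
  have e4 : (1 / 2 : ℝ) • (T ζ + -ζ) = -((inner ℝ (evec (-s) c) ζ : ℝ) • evec (-s) c) := by
    rw [← e3]; module
  have e5 : (inner ℝ (evec (-s) c) ζ : ℝ) • evec (-s) c - -((inner ℝ (evec (-s) c) ζ : ℝ) • evec (-s) c) =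
      (2 * (inner ℝ (evec (-s) c) ζ : ℝ)) • evec (-s) c := by module
  convert key2 using 1
  · ext n; unfold gainF; ring
  · have r1 : ∀ a b : E2, rho ((Du.prod Dv) a) ((Du.prod Dv) b) = ‖Du (a - b)‖ * ‖Dv (a - b)‖ := by
      intro a b; simp [rho]
    rw [← map_add, ← map_add, ← map_smul, ← map_smul, r1, r1, r1, e1, e2, e3, e4, e5]
    congr 1
    simp only [map_smul, norm_smul, norm_mul, Real.norm_eq_abs, Nat.abs_ofNat]
    have q1 := sq_abs (inner ℝ (evec c s) ζ : ℝ)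
    have q2 := sq_abs (inner ℝ (evec (-s) c) ζ : ℝ)
    rw [← q1, ← q2]
    ring

end Part4

section Part5

def aF (Φ : ℂ × ℂ → ℝ) (F : Finset (ZLat 2)) (f g : ZLat 2 → ℂ) (ε : ℝ) (r : ℝ) (x : E2) : ENNReal :=
  ∫⁻ ζ, ENNReal.ofReal (GG Φ F f g r (x + ε • ζ)) ∂gam

def bF (Φ : ℂ × ℂ → ℝ) (F : Finset (ZLat 2)) (f g : ZLat 2 → ℂ) (ε : ℝ) (r : ℝ) (x : E2) : ENNReal :=
  ENNReal.ofReal (GG Φ F f g (r + ε ^ 2) x)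

def EF (Φ : ℂ × ℂ → ℝ) (F : Finset (ZLat 2)) (f g : ZLat 2 → ℂ) (r : ℝ) : ENNReal :=
  ∫⁻ x, ENNReal.ofReal (GG Φ F f g r x)

variable {Φ : ℂ × ℂ → ℝ}

lemma aF_eq (h : Bell Φ) (h0 : Φ 0 = 0) (F : Finset (ZLat 2)) (f g : ZLat 2 → ℂ) (ε : ℝ) {r : ℝ} (hr : 0 < r) (x : E2) :
    aF Φ F f g ε r x = ENNReal.ofReal (∫ ζ, GG Φ F f g r (x + ε • ζ) ∂gam) := by
  unfold aF
  rw [ofReal_integral_eq_lintegral_ofReal (GG_gam h h0 F f g ε hr x)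
    (ae_of_all _ fun ζ => GG_nonneg h F f g hr _)]

lemma aF_meas (h : Bell Φ) (F : Finset (ZLat 2)) (f g : ZLat 2 → ℂ) (ε : ℝ) :
    Measurable fun z : ℝ × E2 => aF Φ F f g ε z.1 z.2 := by
  have : Measurable fun q : (ℝ × E2) × E2 => ENNReal.ofReal (GG Φ F f g q.1.1 (q.1.2 + ε • q.2)) := by
    have h1 : Measurable fun q : (ℝ × E2) × E2 => (q.1.1, q.1.2 + ε • q.2) := by fun_prop
    exact ((GG_meas h F f g).comp h1).ennreal_ofReal
  exact this.lintegral_prod_right'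

lemma bF_meas (h : Bell Φ) (F : Finset (ZLat 2)) (f g : ZLat 2 → ℂ) (ε : ℝ) :
    Measurable fun z : ℝ × E2 => bF Φ F f g ε z.1 z.2 := by
  have h1 : Measurable fun q : ℝ × E2 => (q.1 + ε ^ 2, q.2) := by fun_prop
  exact ((GG_meas h F f g).comp h1).ennreal_ofReal

lemma EF_meas (h : Bell Φ) (F : Finset (ZLat 2)) (f g : ZLat 2 → ℂ) : Measurable (EF Φ F f g) :=
  (GG_meas h F f g).ennreal_ofReal.lintegral_prod_right'

lemma aF_int (h : Bell Φ) (F : Finset (ZLat 2)) (f g : ZLat 2 → ℂ) (ε r : ℝ) :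
    ∫⁻ x, aF Φ F f g ε r x = EF Φ F f g r := by
  unfold aF
  rw [lintegral_lintegral_swap]
  · have : ∀ ζ : E2, ∫⁻ x, ENNReal.ofReal (GG Φ F f g r (x + ε • ζ)) = EF Φ F f g r := fun ζ =>
      lintegral_add_right_eq_self (fun x => ENNReal.ofReal (GG Φ F f g r x)) (ε • ζ)
    simp_rw [this]
    simp
  · have h1 : Measurable fun q : E2 × E2 => (r, q.1 + ε • q.2) := by fun_prop
    exact ((GG_meas h F f g).comp h1).ennreal_ofReal.aemeasurable

lemma EF_le (h : Bell Φ) (h0 : Φ 0 = 0) (F : Finset (ZLat 2)) (f g : ZLat 2 → ℂ) {r : ℝ} (hr : 0 < r) :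
    EF Φ F f g r ≤ ENNReal.ofReal (∑ m ∈ F, Φ (f m, g m)) := by
  unfold EF
  calc ∫⁻ x, ENNReal.ofReal (GG Φ F f g r x)
      ≤ ∫⁻ x, ∑ m ∈ F, ENNReal.ofReal (heatK 2 r (x - latVec m)) * ENNReal.ofReal (Φ (f m, g m)) := by
        refine lintegral_mono fun x => ?_
        refine (ENNReal.ofReal_le_ofReal (GG_le h h0 F f g hr x)).trans_eq ?_
        rw [ENNReal.ofReal_sum_of_nonneg (fun m _ => mul_nonneg (heatK_pos hr _).le (h.nonneg _))]
        exact Finset.sum_congr rfl fun m _ => ENNReal.ofReal_mul (heatK_pos hr _).le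
    _ = ENNReal.ofReal (∑ m ∈ F, Φ (f m, g m)) := by
        rw [lintegral_finsetSum, ENNReal.ofReal_sum_of_nonneg (fun m _ => h.nonneg _)]
        · refine Finset.sum_congr rfl fun m _ => ?_
          rw [lintegral_mul_const _ (by simp only [heatK_eq]; fun_prop), heatK_lint hr, one_mul]
        · intro m _
          simp only [heatK_eq]; fun_prop

lemma meas_slice {β : Type*} [MeasurableSpace β] {k : ℝ → E2 → β} (hk : Measurable fun z : ℝ × E2 => k z.1 z.2) (r : ℝ) :
    Measurable (k r) := by
  have h1 : Measurable fun x : E2 => (r, x) := by fun_prop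
  exact hk.comp h1

lemma core_int (h : Bell Φ) (h0 : Φ 0 = 0) (F : Finset (ZLat 2)) (f g : ZLat 2 → ℂ) (ε : ℝ) (hε : 0 < ε) (T : ℝ)
    (hT : ε ^ 2 ≤ T) :
    ∫⁻ r in Set.Ioo 0 T, ∫⁻ x, (aF Φ F f g ε r x - bF Φ F f g ε r x) ≤
      ENNReal.ofReal (ε ^ 2) * ENNReal.ofReal (∑ m ∈ F, Φ (f m, g m)) := by
  set C := ENNReal.ofReal (∑ m ∈ F, Φ (f m, g m)) with hC
  have hε2 : 0 < ε ^ 2 := by positivity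
  have e1 : ∀ r ∈ Set.Ioo 0 T, ∫⁻ x, (aF Φ F f g ε r x - bF Φ F f g ε r x) = EF Φ F f g r - EF Φ F f g (r + ε ^ 2) := by
    intro r hr
    have hr0 : 0 < r := hr.1
    have hb : Measurable (bF Φ F f g ε r) := meas_slice (bF_meas h F f g ε) r
    rw [lintegral_sub hb, aF_int h]
    · rfl
    · exact ((EF_le h h0 F f g (by positivity : 0 < r + ε ^ 2)).trans_lt ENNReal.ofReal_lt_top).ne
    · refine ae_of_all _ fun x => ?_
      rw [aF_eq h h0 F f g ε hr0]
      exact ENNReal.ofReal_le_ofReal (gain_le h h0 F f g ε hr0 x (LinearIsometryEquiv.refl ℝ E2)).1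
  rw [setLIntegral_congr_fun measurableSet_Ioo e1]
  have hm2 : Measurable fun r => EF Φ F f g (r + ε ^ 2) := (EF_meas h F f g).comp (by fun_prop)
  have e3 : ∫⁻ r in Set.Ioo 0 T, EF Φ F f g (r + ε ^ 2) = ∫⁻ r in Set.Ioo (ε ^ 2) (T + ε ^ 2), EF Φ F f g r := by
    have := (measurePreserving_add_right (volume : Measure ℝ) (ε ^ 2)).setLIntegral_comp_preimage
      (measurableSet_Ioo (a := ε ^ 2) (b := T + ε ^ 2)) (EF_meas h F f g)
    rw [← this]
    congr 2
    ext r; simp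
  have hfin : ∫⁻ r in Set.Ioo 0 T, EF Φ F f g (r + ε ^ 2) ≤ C * ENNReal.ofReal T := by
    calc _ ≤ ∫⁻ r in Set.Ioo 0 T, C := setLIntegral_mono' measurableSet_Ioo fun r hr =>
            EF_le h h0 F f g (by have := hr.1; positivity)
      _ = _ := by simp
  rw [lintegral_sub hm2 (hfin.trans_lt (ENNReal.mul_lt_top ENNReal.ofReal_lt_top ENNReal.ofReal_lt_top)).ne]
  · rw [tsub_le_iff_right, e3]
    calc ∫⁻ r in Set.Ioo 0 T, EF Φ F f g r
        ≤ ∫⁻ r in Set.Ioc 0 (ε ^ 2) ∪ Set.Ioo (ε ^ 2) (T + ε ^ 2), EF Φ F f g r := by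
          refine lintegral_mono_set fun r hr => ?_
          rcases le_or_gt r (ε ^ 2) with h1 | h1
          · exact Or.inl ⟨hr.1, h1⟩
          · exact Or.inr ⟨h1, by linarith [hr.2]⟩
      _ ≤ _ := lintegral_union_le _ _ _
      _ ≤ _ := by
          gcongr
          calc _ ≤ ∫⁻ r in Set.Ioc 0 (ε ^ 2), C := setLIntegral_mono' measurableSet_Ioc fun r hr =>
                EF_le h h0 F f g hr.1
            _ = _ := by simp [mul_comm]
  · refine (ae_restrict_iff' measurableSet_Ioo).2 (ae_of_all _ fun r hr => ?_)
    have hr0 : 0 < r := hr.1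
    show EF Φ F f g (r + ε ^ 2) ≤ EF Φ F f g r
    rw [← aF_int h F f g ε r]
    refine lintegral_mono fun x => ?_
    rw [aF_eq h h0 F f g ε hr0]
    exact ENNReal.ofReal_le_ofReal (gain_le h h0 F f g ε hr0 x (LinearIsometryEquiv.refl ℝ E2)).1

def basisS (F : Finset (ZLat 2)) (f g : ZLat 2 → ℂ) (r : ℝ) (x : E2) (c s : ℝ) : ℝ :=
  pHeatK 2 r x * (‖fderiv ℝ (uu F f r) x (evec c s)‖ * ‖fderiv ℝ (uu F g r) x (evec c s)‖ +
    ‖fderiv ℝ (uu F f r) x (evec (-s) c)‖ * ‖fderiv ℝ (uu F g r) x (evec (-s) c)‖)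

lemma core_pt (h : Bell Φ) (h0 : Φ 0 = 0) (F : Finset (ZLat 2)) (f g : ZLat 2 → ℂ) {r : ℝ} (hr : 0 < r) (x : E2)
    {c s : ℝ} (hcs : c ^ 2 + s ^ 2 = 1) :
    ENNReal.ofReal (basisS F f g r x c s) ≤ liminf (fun n : ℕ => ENNReal.ofReal (((n : ℝ) + 1) ^ 2) *
      (aF Φ F f g ((n : ℝ) + 1)⁻¹ r x - bF Φ F f g ((n : ℝ) + 1)⁻¹ r x)) atTop := by
  have hH := (pHeatK_pos hr x).le
  set X := pHeatK 2 r x * (‖fderiv ℝ (uu F f r) x (evec c s)‖ * ‖fderiv ℝ (uu F g r) x (evec c s)‖) with hX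
  set Y := pHeatK 2 r x * (‖fderiv ℝ (uu F f r) x (evec (-s) c)‖ * ‖fderiv ℝ (uu F g r) x (evec (-s) c)‖) with hY
  have hX0 : 0 ≤ X := by positivity
  have hY0 : 0 ≤ Y := by positivity
  have hb : basisS F f g r x c s = X + Y := by unfold basisS; rw [hX, hY]; ring
  set T := Submodule.reflection (ℝ ∙ (evec c s))
  calc ENNReal.ofReal (basisS F f g r x c s)
      = ENNReal.ofReal X * 1 + ENNReal.ofReal Y * 1 := by rw [hb, mul_one, mul_one, ENNReal.ofReal_add hX0 hY0]
    _ ≤ ENNReal.ofReal X * ∫⁻ ζ, ENNReal.ofReal ((inner ℝ (evec c s) ζ : ℝ) ^ 2) ∂gam +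
        ENNReal.ofReal Y * ∫⁻ ζ, ENNReal.ofReal ((inner ℝ (evec (-s) c) ζ : ℝ) ^ 2) ∂gam := by
        gcongr
        · exact evec_moment hcs
        · exact evec_moment (by rw [← hcs]; ring)
    _ = ∫⁻ ζ, ENNReal.ofReal (X * (inner ℝ (evec c s) ζ : ℝ) ^ 2 + Y * (inner ℝ (evec (-s) c) ζ : ℝ) ^ 2) ∂gam := by
        rw [← lintegral_const_mul _ (by fun_prop), ← lintegral_const_mul _ (by fun_prop),
          ← lintegral_add_left (by fun_prop)]
        refine lintegral_congr fun ζ => ?_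
        rw [ENNReal.ofReal_add (by positivity) (by positivity), ENNReal.ofReal_mul hX0, ENNReal.ofReal_mul hY0]
    _ = ∫⁻ ζ, liminf (fun n : ℕ => ENNReal.ofReal (((n : ℝ) + 1) ^ 2 * gainF F f g r x ((n : ℝ) + 1)⁻¹ T ζ)) atTop ∂gam := by
        refine lintegral_congr fun ζ => ?_
        have := (ENNReal.continuous_ofReal.tendsto _).comp (gain_lim F f g hr x hcs ζ)
        exact this.liminf_eq.symm
    _ ≤ liminf (fun n : ℕ => ∫⁻ ζ, ENNReal.ofReal (((n : ℝ) + 1) ^ 2 * gainF F f g r x ((n : ℝ) + 1)⁻¹ T ζ) ∂gam) atTop :=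
        lintegral_liminf_le fun n => ((gainF_meas F f g hr x _ T).const_mul _).ennreal_ofReal
    _ ≤ _ := by
        refine liminf_le_liminf (Eventually.of_forall fun n => ?_)
        have hg := gain_le h h0 F f g ((n : ℝ) + 1)⁻¹ hr x T
        have e1 : ∀ ζ, ENNReal.ofReal (((n : ℝ) + 1) ^ 2 * gainF F f g r x ((n : ℝ) + 1)⁻¹ T ζ) =
            ENNReal.ofReal (((n : ℝ) + 1) ^ 2) * ENNReal.ofReal (gainF F f g r x ((n : ℝ) + 1)⁻¹ T ζ) :=
          fun ζ => ENNReal.ofReal_mul (by positivity)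
        simp_rw [e1]
        rw [lintegral_const_mul _ (gainF_meas F f g hr x _ T).ennreal_ofReal]
        refine mul_le_mul_right (hg.2.trans_eq ?_) _
        rw [ENNReal.ofReal_sub _ (GG_nonneg h F f g (by positivity) x), aF_eq h h0 F f g _ hr]
        rfl

lemma core (h : Bell Φ) (h0 : Φ 0 = 0) (F : Finset (ZLat 2)) (f g : ZLat 2 → ℂ) (S : ℝ → E2 → ENNReal)
    (hS : ∀ r, 0 < r → ∀ x, ∃ c s : ℝ, c ^ 2 + s ^ 2 = 1 ∧ S r x ≤ ENNReal.ofReal (basisS F f g r x c s)) :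
    ∫⁻ r in Set.Ioi (0 : ℝ), ∫⁻ x, S r x ≤ ENNReal.ofReal (∑ m ∈ F, Φ (f m, g m)) := by
  set C := ENNReal.ofReal (∑ m ∈ F, Φ (f m, g m)) with hC
  let D : ℕ → ℝ → E2 → ENNReal := fun n r x => ENNReal.ofReal (((n : ℝ) + 1) ^ 2) *
      (aF Φ F f g ((n : ℝ) + 1)⁻¹ r x - bF Φ F f g ((n : ℝ) + 1)⁻¹ r x)
  have hDm : ∀ n, Measurable fun z : ℝ × E2 => D n z.1 z.2 := fun n =>
    ((aF_meas h F f g _).sub (bF_meas h F f g _)).const_mul _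
  let J : ℕ → ℝ → ENNReal := fun n => (Set.Ioo (0 : ℝ) (n + 1)).indicator fun r => ∫⁻ x, D n r x
  have hJm : ∀ n, Measurable (J n) := fun n => ((hDm n).lintegral_prod_right').indicator measurableSet_Ioo
  calc ∫⁻ r in Set.Ioi (0 : ℝ), ∫⁻ x, S r x
      ≤ ∫⁻ r in Set.Ioi (0 : ℝ), liminf (fun n => J n r) atTop := by
        refine setLIntegral_mono' measurableSet_Ioi fun r hr => ?_
        have hr0 : 0 < r := hr
        calc ∫⁻ x, S r x ≤ ∫⁻ x, liminf (fun n => D n r x) atTop := by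
              refine lintegral_mono fun x => ?_
              obtain ⟨c, s, hcs, hle⟩ := hS r hr0 x
              exact hle.trans (core_pt h h0 F f g hr0 x hcs)
          _ ≤ liminf (fun n => ∫⁻ x, D n r x) atTop :=
              lintegral_liminf_le fun n => meas_slice (hDm n) r
          _ = liminf (fun n => J n r) atTop := by
              refine liminf_congr ?_
              filter_upwards [eventually_ge_atTop ⌈r⌉₊] with n hn
              have : r < n + 1 := by
                have := Nat.le_of_ceil_le hn
                linarith
              simp only [J]
              rw [Set.indicator_of_mem]
              exact ⟨hr0, this⟩
    _ ≤ liminf (fun n => ∫⁻ r in Set.Ioi (0 : ℝ), J n r) atTop := lintegral_liminf_le hJm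
    _ ≤ C := by
        refine liminf_le_of_le (by isBoundedDefault) ?_
        intro b hb
        obtain ⟨n, hn⟩ := hb.exists
        refine hn.trans ?_
        have hn1 : (1 : ℝ) ≤ (n : ℝ) + 1 := by simp
        calc ∫⁻ r in Set.Ioi (0 : ℝ), J n r ≤ ∫⁻ r, J n r := setLIntegral_le_lintegral _ _
          _ = ∫⁻ r in Set.Ioo (0 : ℝ) (n + 1), ∫⁻ x, D n r x := lintegral_indicator measurableSet_Ioo _
          _ = ENNReal.ofReal (((n : ℝ) + 1) ^ 2) * ∫⁻ r in Set.Ioo (0 : ℝ) (n + 1),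
              ∫⁻ x, (aF Φ F f g ((n : ℝ) + 1)⁻¹ r x - bF Φ F f g ((n : ℝ) + 1)⁻¹ r x) := by
              rw [← lintegral_const_mul' _ _ ENNReal.ofReal_ne_top]
              simp only [D]
              refine lintegral_congr fun r => ?_
              rw [lintegral_const_mul' _ _ ENNReal.ofReal_ne_top]
          _ ≤ ENNReal.ofReal (((n : ℝ) + 1) ^ 2) * (ENNReal.ofReal ((((n : ℝ) + 1)⁻¹) ^ 2) * C) := by
              gcongr
              refine core_int h h0 F f g _ (by positivity) _ ?_
              have : (((n : ℝ) + 1)⁻¹) ≤ 1 := inv_le_one_of_one_le₀ hn1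
              have h2 : 0 < (((n : ℝ) + 1)⁻¹) := by positivity
              nlinarith
          _ = C := by
              rw [← mul_assoc, ← ENNReal.ofReal_mul (by positivity), ← mul_pow, mul_inv_cancel₀ (by positivity)]
              simp

end Part5

section Part6

abbrev mu : Measure (ℝ × E2) := (volume.restrict (Set.Ioi (0 : ℝ))).prod (volume : Measure E2)

def dd (j : Fin 2) (m : ZLat 2) (s : ℝ) (x : E2) : ℝ := pderiv j (hh m s) x

lemma mu_pos : ∀ᵐ z ∂mu, 0 < z.1 := by
  have h1 : ∀ᵐ s ∂(volume.restrict (Set.Ioi (0 : ℝ))), 0 < s := ae_restrict_mem measurableSet_Ioi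
  exact Measure.quasiMeasurePreserving_fst.ae h1

lemma dd_aem (j : Fin 2) (m : ZLat 2) : AEMeasurable (fun z : ℝ × E2 => dd j m z.1 z.2) mu := by
  let q : ℕ → ℝ × E2 → ℝ := fun n z => ((n : ℝ) + 1) *
    (hh m z.1 (z.2 + ((n : ℝ) + 1)⁻¹ • EuclideanSpace.single j (1 : ℝ)) - hh m z.1 z.2)
  have hq : ∀ n, Measurable (q n) := by
    intro n
    have h1 : Measurable fun z : ℝ × E2 => (z.1, z.2 + ((n : ℝ) + 1)⁻¹ • (EuclideanSpace.single j (1 : ℝ) : E2)) := by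
      fun_prop
    have h2 : Measurable fun z : ℝ × E2 => hh m z.1 (z.2 + ((n : ℝ) + 1)⁻¹ • EuclideanSpace.single j (1 : ℝ)) :=
      (hh_meas m).comp h1
    exact (h2.sub (hh_meas m)).const_mul _
  refine aemeasurable_of_tendsto_metrizable_ae (u := atTop) (f := q) (fun n => (hq n).aemeasurable) ?_
  filter_upwards [mu_pos] with z hz
  have h1 := ((hh_diff hz m z.2).hasFDerivAt).lim_real (EuclideanSpace.single j (1 : ℝ))
  have h2 : Tendsto (fun n : ℕ => (n : ℝ) + 1) atTop atTop := tendsto_atTop_add_const_right _ _ tendsto_natCast_atTop_atTop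
  exact h1.comp h2

lemma evec_lin (c s : ℝ) : evec c s = c • EuclideanSpace.single (0 : Fin 2) (1 : ℝ) + s • EuclideanSpace.single (1 : Fin 2) (1 : ℝ) := by
  ext i; fin_cases i <;> simp [evec]

lemma uu_fderiv (F : Finset (ZLat 2)) (f : ZLat 2 → ℂ) {s : ℝ} (hs : 0 < s) (x v : E2) :
    fderiv ℝ (uu F f s) x v = ∑ m ∈ F, ((fderiv ℝ (hh m s) x v : ℝ) : ℂ) * f m := by
  have h1 : HasFDerivAt (uu F f s) (∑ m ∈ F, (fderiv ℝ (hh m s) x).smulRight (f m)) x := by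
    unfold uu
    exact HasFDerivAt.fun_sum fun m _ => ((hh_diff hs m x).hasFDerivAt).smul_const (f m)
  rw [h1.fderiv]
  simp

def au (j : Fin 2) (F : Finset (ZLat 2)) (f : ZLat 2 → ℂ) (s : ℝ) (x : E2) : ℂ := ∑ m ∈ F, (dd j m s x : ℂ) * f m

lemma uu_evec (F : Finset (ZLat 2)) (f : ZLat 2 → ℂ) {r : ℝ} (hr : 0 < r) (x : E2) (c s : ℝ) :
    fderiv ℝ (uu F f r) x (evec c s) = c * au 0 F f r x + s * au 1 F f r x := by
  rw [evec_lin, map_add, map_smul, map_smul, uu_fderiv F f hr, uu_fderiv F f hr]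
  simp [au, dd, pderiv]

lemma basisS_eq (F : Finset (ZLat 2)) (f g : ZLat 2 → ℂ) {r : ℝ} (hr : 0 < r) (x : E2) (c s : ℝ) :
    basisS F f g r x c s = pHeatK 2 r x * (‖c * au 0 F f r x + s * au 1 F f r x‖ * ‖c * au 0 F g r x + s * au 1 F g r x‖ +
    ‖-s * au 0 F f r x + c * au 1 F f r x‖ * ‖-s * au 0 F g r x + c * au 1 F g r x‖) := by
  unfold basisS
  rw [uu_evec F f hr, uu_evec F f hr, uu_evec F g hr, uu_evec F g hr]
  push_cast
  rfl

lemma bell_some : ∃ Φ : ℂ × ℂ → ℝ, Bell Φ ∧ Φ 0 = 0 := by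
  obtain ⟨Φ, h, hb⟩ := bell_exists 2 2 Real.HolderConjugate.two_two
  refine ⟨Φ, h, le_antisymm ?_ (h.nonneg _)⟩
  have h1 : Φ 0 ≤ _ := hb 0 0
  exact h1.trans (by simp)

lemma dd_sq (j : Fin 2) (m : ZLat 2) :
    ∫⁻ z, ENNReal.ofReal (pHeatK 2 z.1 z.2 * (dd j m z.1 z.2) ^ 2) ∂mu < ⊤ := by
  obtain ⟨Φ, h, h0⟩ := bell_some
  have hm : AEMeasurable (fun z : ℝ × E2 => ENNReal.ofReal (pHeatK 2 z.1 z.2 * (dd j m z.1 z.2) ^ 2)) mu :=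
    (pHeatK_meas.aemeasurable.mul ((dd_aem j m).pow_const 2)).ennreal_ofReal
  rw [lintegral_prod _ hm]
  refine (core h h0 {m} (fun _ => 1) (fun _ => 1)
    (fun r x => ENNReal.ofReal (pHeatK 2 r x * (dd j m r x) ^ 2)) ?_).trans_lt ENNReal.ofReal_lt_top
  intro r hr x
  refine ⟨1, 0, by simp, ENNReal.ofReal_le_ofReal ?_⟩
  rw [basisS_eq _ _ _ hr]
  have := (pHeatK_pos hr x).le
  gcongr
  simp only [au, Finset.sum_singleton, mul_one, Complex.ofReal_one, Complex.ofReal_zero, one_mul, zero_mul, add_zero, neg_zero, zero_add, Complex.norm_real, Real.norm_eq_abs, abs_mul_abs_self]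
  fin_cases j <;> simp <;> nlinarith [sq_nonneg (dd 0 m r x), sq_nonneg (dd 1 m r x)]

def kk (j k : Fin 2) (m n : ZLat 2) (z : ℝ × E2) : ℝ :=
  pHeatK 2 z.1 z.2 * (dd j m z.1 z.2 * dd k n z.1 z.2)

lemma kk_int (j k : Fin 2) (m n : ZLat 2) : Integrable (kk j k m n) mu := by
  have hsq : ∀ j m, Integrable (fun z : ℝ × E2 => pHeatK 2 z.1 z.2 * (dd j m z.1 z.2) ^ 2) mu := by
    intro j m
    have hm : AEMeasurable (fun z : ℝ × E2 => pHeatK 2 z.1 z.2 * (dd j m z.1 z.2) ^ 2) mu :=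
      pHeatK_meas.aemeasurable.mul ((dd_aem j m).pow_const 2)
    refine ⟨hm.aestronglyMeasurable, ?_⟩
    rw [hasFiniteIntegral_iff_ofReal]
    · exact dd_sq j m
    · filter_upwards [mu_pos] with z hz
      have := (pHeatK_pos hz z.2).le
      simp only [Pi.zero_apply]; positivity
  refine ((hsq j m).add (hsq k n)).mono' ?_ ?_
  · exact (pHeatK_meas.aemeasurable.mul ((dd_aem j m).mul (dd_aem k n))).aestronglyMeasurable
  · filter_upwards [mu_pos] with z hz
    have := (pHeatK_pos hz z.2).le
    simp only [kk, Pi.add_apply]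
    rw [norm_mul, norm_mul, Real.norm_of_nonneg this, ← mul_add, Real.norm_eq_abs, Real.norm_eq_abs]
    gcongr
    rw [← sq_abs (dd j m _ _), ← sq_abs (dd k n _ _)]
    nlinarith [sq_nonneg (|dd j m z.1 z.2| - |dd k n z.1 z.2|), sq_nonneg (|dd j m z.1 z.2|), sq_nonneg (|dd k n z.1 z.2|)]

def DD (j k : Fin 2) (m n : ZLat 2) : ℝ := ∫ z, kk j k m n z ∂mu

lemma DD_eq (j k : Fin 2) (m n : ZLat 2) :
    DD j k m n = ∫ s in Set.Ioi (0 : ℝ), ∫ x : E2, pHeatK 2 s x * (dd j m s x * dd k n s x) :=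
  integral_prod _ (kk_int j k m n)

lemma probK_zero (j k : Fin 2) (n : ZLat 2) : probK 2 j k n = -DD j k 0 n := by
  rw [DD_eq, probK]
  have : ∀ s, hh 0 s = fun y => heatK 2 s y / pHeatK 2 s y := by
    intro s; funext y; simp [hh, latVec_zero]
  simp only [dd, this]
  rfl

lemma pHeatK_add (s : ℝ) (x : E2) (m : ZLat 2) : pHeatK 2 s (x + latVec m) = pHeatK 2 s x := by
  rw [← pHeatK_periodic s (x + latVec m) m, add_sub_cancel_right]

lemma dd_shift (j : Fin 2) (m n : ZLat 2) (s : ℝ) (x : E2) : dd j n s (x + latVec m) = dd j (n - m) s x := by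
  have : hh (n - m) s = fun y => hh n s (y + latVec m) := by
    funext y
    simp only [hh, pHeatK_add, latVec_sub]
    congr 2
    abel
  simp only [dd, pderiv, this]
  rw [fderiv_comp_add_right]

lemma dd_refl (j : Fin 2) (m n : ZLat 2) {s : ℝ} (hs : 0 < s) (x : E2) : dd j n s (latVec m - x) = -dd j (m - n) s x := by
  have : hh (m - n) s = fun y => hh n s (latVec m - y) := by
    funext y
    have e1 : pHeatK 2 s (latVec m - y) = pHeatK 2 s y := by
      rw [← pHeatK_neg s y, ← pHeatK_add s (-y) m, neg_add_eq_sub]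
    simp only [hh, e1, latVec_sub]
    rw [← heatK_neg]
    congr 2
    abel
  simp only [dd, pderiv, this]
  have h1 : HasFDerivAt (fun y : E2 => latVec m - y) (-(ContinuousLinearMap.id ℝ E2)) x := (hasFDerivAt_id x).const_sub _
  have h2 := ((hh_diff hs n (latVec m - x)).hasFDerivAt).comp x h1
  have h3 : fderiv ℝ (fun y => hh n s (latVec m - y)) x = _ := h2.fderiv
  rw [h3]
  simp

lemma DD_shift (j k : Fin 2) (m n : ZLat 2) : DD j k m n = DD j k 0 (n - m) := by
  rw [DD_eq, DD_eq]
  refine setIntegral_congr_fun measurableSet_Ioi fun s hs => ?_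
  rw [← integral_add_right_eq_self _ (latVec m)]
  simp only [pHeatK_add, dd_shift, sub_self]

lemma DD_refl (j k : Fin 2) (m n : ZLat 2) : DD j k m n = DD k j 0 (n - m) := by
  rw [DD_eq, DD_eq]
  refine setIntegral_congr_fun measurableSet_Ioi fun s hs => ?_
  rw [← integral_sub_left_eq_self _ _ (latVec n)]
  congr 1
  funext x
  have e1 : pHeatK 2 s (latVec n - x) = pHeatK 2 s x := by
    rw [← pHeatK_neg s x, ← pHeatK_add s (-x) n, neg_add_eq_sub]
  rw [e1, dd_refl j n m hs, dd_refl k n n hs, sub_self]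
  ring

lemma probK_DD (j k : Fin 2) (m n : ZLat 2) : probK 2 j k (n - m) = -DD j k m n := by
  rw [probK_zero, DD_shift j k m n]

lemma probK_DD' (j k : Fin 2) (m n : ZLat 2) : probK 2 k j (n - m) = -DD j k m n := by
  rw [probK_zero, DD_refl j k m n]

def kC (m n : ZLat 2) (z : ℝ × E2) : ℂ :=
  ((kk 1 1 m n z : ℝ) : ℂ) - ((kk 0 0 m n z : ℝ) : ℂ) + Complex.I * (((kk 1 0 m n z : ℝ) : ℂ) + ((kk 0 1 m n z : ℝ) : ℂ))

lemma kC_int (m n : ZLat 2) : Integrable (kC m n) mu := by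
  unfold kC
  exact (((kk_int 1 1 m n).ofReal).sub (kk_int 0 0 m n).ofReal).add
    ((((kk_int 1 0 m n).ofReal).add (kk_int 0 1 m n).ofReal).const_mul _)

lemma BAker_eq (m n : ZLat 2) : BAker (n - m) = -∫ z, kC m n z ∂mu := by
  have h : ∫ z, kC m n z ∂mu = (DD 1 1 m n : ℂ) - DD 0 0 m n + Complex.I * (DD 1 0 m n + DD 0 1 m n) := by
    unfold kC
    rw [integral_add, integral_sub, integral_const_mul, integral_add]
    · simp only [integral_complex_ofReal]; rfl
    · exact (kk_int 1 0 m n).ofReal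
    · exact (kk_int 0 1 m n).ofReal
    · exact (kk_int 1 1 m n).ofReal
    · exact (kk_int 0 0 m n).ofReal
    · exact ((kk_int 1 1 m n).ofReal).sub (kk_int 0 0 m n).ofReal
    · exact (((kk_int 1 0 m n).ofReal).add (kk_int 0 1 m n).ofReal).const_mul _
  have e : DD 1 0 m n = DD 0 1 m n := by
    have h1 := probK_DD 1 0 m n
    have h2 := probK_DD' 0 1 m n
    linarith
  rw [h, BAker, probK_DD, probK_DD, probK_DD, e]
  push_cast
  ring

def form (F : Finset (ZLat 2)) (f g : ZLat 2 → ℂ) (r : ℝ) (x : E2) : ℂ :=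
  pHeatK 2 r x * ((au 1 F f r x * au 1 F g r x - au 0 F f r x * au 0 F g r x) +
    Complex.I * (au 1 F f r x * au 0 F g r x + au 0 F f r x * au 1 F g r x))

lemma form_eq (F : Finset (ZLat 2)) (f g : ZLat 2 → ℂ) (r : ℝ) (x : E2) :
    form F f g r x = ∑ n ∈ F, ∑ m ∈ F, (g n * f m) * kC m n (r, x) := by
  unfold form kC kk
  have e : ∀ j k, au j F f r x * au k F g r x = ∑ n ∈ F, ∑ m ∈ F, (g n * f m) * ((dd j m r x : ℂ) * dd k n r x) := by
    intro j k
    unfold au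
    rw [mul_comm, Finset.sum_mul_sum]
    refine Finset.sum_congr rfl fun n _ => Finset.sum_congr rfl fun m _ => ?_
    ring
  rw [e, e, e, e]
  simp only [← Finset.sum_sub_distrib, ← Finset.sum_add_distrib, Finset.mul_sum]
  refine Finset.sum_congr rfl fun n _ => Finset.sum_congr rfl fun m _ => ?_
  push_cast
  ring

lemma form_int (F : Finset (ZLat 2)) (f g : ZLat 2 → ℂ) : Integrable (fun z : ℝ × E2 => form F f g z.1 z.2) mu := by
  simp only [form_eq]
  exact integrable_finsetSum _ fun n _ => integrable_finsetSum _ fun m _ => (kC_int m n).const_mul _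

lemma bil_eq (F : Finset (ZLat 2)) (f g : ZLat 2 → ℂ) :
    ∑ n ∈ F, g n * ∑ m ∈ F, BAker (n - m) * f m = -∫ z, form F f g z.1 z.2 ∂mu := by
  simp only [form_eq]
  rw [integral_finsetSum _ fun n _ => integrable_finsetSum _ fun m _ => (kC_int m n).const_mul _,
    ← Finset.sum_neg_distrib]
  refine Finset.sum_congr rfl fun n _ => ?_
  rw [integral_finsetSum _ fun m _ => (kC_int m n).const_mul _, ← Finset.sum_neg_distrib, Finset.mul_sum]
  refine Finset.sum_congr rfl fun m _ => ?_
  rw [integral_const_mul, BAker_eq]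
  ring

end Part6

lemma pt_c (a0 a1 b0 b1 : ℂ) : ∃ c s : ℝ, c ^ 2 + s ^ 2 = 1 ∧
    ‖(a1 * b1 - a0 * b0) + Complex.I * (a1 * b0 + a0 * b1)‖ ≤
      2 * (‖c * a0 + s * a1‖ * ‖c * b0 + s * b1‖ + ‖-s * a0 + c * a1‖ * ‖-s * b0 + c * b1‖) := by
  set k : ℝ := √2 / 2 with hk
  have hk2 : k ^ 2 = 1 / 2 := by rw [hk, div_pow, Real.sq_sqrt (by norm_num)]; norm_num
  have hkc : (k : ℂ) ^ 2 = 1 / 2 := by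
    have := congrArg (fun r : ℝ => (r : ℂ)) hk2
    push_cast at this; exact this
  set X := ‖(1 : ℝ) * a0 + (0 : ℝ) * a1‖ * ‖(1 : ℝ) * b0 + (0 : ℝ) * b1‖ +
    ‖-(0 : ℝ) * a0 + (1 : ℝ) * a1‖ * ‖-(0 : ℝ) * b0 + (1 : ℝ) * b1‖ with hX
  set Y := ‖k * a0 + k * a1‖ * ‖k * b0 + k * b1‖ + ‖-k * a0 + k * a1‖ * ‖-k * b0 + k * b1‖ with hY
  have h1 : ‖a1 * b1 - a0 * b0‖ ≤ X := by
    refine (norm_sub_le _ _).trans (le_of_eq ?_)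
    rw [hX]; simp; ring
  have h2 : ‖a1 * b0 + a0 * b1‖ ≤ Y := by
    have e : a1 * b0 + a0 * b1 = (k * a0 + k * a1) * (k * b0 + k * b1) - (-k * a0 + k * a1) * (-k * b0 + k * b1) := by
      linear_combination (-2 * (a1 * b0 + a0 * b1)) * hkc
    rw [e, hY, ← norm_mul, ← norm_mul]
    exact norm_sub_le _ _
  have h3 : ‖(a1 * b1 - a0 * b0) + Complex.I * (a1 * b0 + a0 * b1)‖ ≤ X + Y := by
    refine (norm_add_le _ _).trans ?_
    rw [norm_mul, Complex.norm_I, one_mul]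
    linarith
  rcases le_total X Y with h | h
  · exact ⟨k, k, by linarith, by linarith⟩
  · exact ⟨1, 0, by norm_num, by linarith⟩

lemma pt_r (a0 a1 : ℝ) (b0 b1 : ℂ) : ∃ c s : ℝ, c ^ 2 + s ^ 2 = 1 ∧
    ‖((a1 : ℂ) * b1 - a0 * b0) + Complex.I * (a1 * b0 + a0 * b1)‖ ≤
      √2 * (‖c * (a0 : ℂ) + s * a1‖ * ‖c * b0 + s * b1‖ + ‖-s * (a0 : ℂ) + c * a1‖ * ‖-s * b0 + c * b1‖) := by
  by_cases h0 : a0 = 0 ∧ a1 = 0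
  · refine ⟨1, 0, by norm_num, ?_⟩
    simp [h0.1, h0.2]
  have hn : 0 < 2 * (a0 ^ 2 + a1 ^ 2) := by
    by_contra hh
    have : a0 ^ 2 + a1 ^ 2 ≤ 0 := by linarith
    exact h0 ⟨by nlinarith [sq_nonneg a0, sq_nonneg a1], by nlinarith [sq_nonneg a0, sq_nonneg a1]⟩
  set L := √(2 * (a0 ^ 2 + a1 ^ 2)) with hL
  have hL0 : 0 < L := Real.sqrt_pos.2 hn
  have hL2 : L ^ 2 = 2 * (a0 ^ 2 + a1 ^ 2) := Real.sq_sqrt hn.le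
  set c := (a0 + a1) / L with hc
  set s := (a1 - a0) / L with hs
  have hcs : c ^ 2 + s ^ 2 = 1 := by
    rw [hc, hs]; field_simp; rw [hL2]; ring
  have e1 : c * a0 + s * a1 = -s * a0 + c * a1 := by rw [hc, hs]; field_simp; ring
  set A := c * a0 + s * a1 with hA
  have e1c : (c : ℂ) * a0 + s * a1 = (A : ℂ) := by rw [hA]; push_cast; rfl
  have e2c : -(s : ℂ) * a0 + c * a1 = (A : ℂ) := by rw [e1]; push_cast; rfl
  have hcsc : (c : ℂ) ^ 2 + (s : ℂ) ^ 2 = 1 := by exact_mod_cast hcs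
  refine ⟨c, s, hcs, ?_⟩
  rw [e1c, e2c]
  -- rotation identity
  have key : ((a1 : ℂ) * b1 - a0 * b0) + Complex.I * (a1 * b0 + a0 * b1) =
      -((c - Complex.I * s) ^ 2 * (1 - Complex.I) * A * ((c * b0 + s * b1) - Complex.I * (-s * b0 + c * b1))) := by
    have r1 : (a0 : ℂ) - Complex.I * a1 = (c - Complex.I * s) * (1 - Complex.I) * A := by
      have : (1 - Complex.I) * A = A - Complex.I * A := by ring
      rw [mul_assoc, this]
      nth_rw 1 [← e1c]
      rw [← e2c]
      linear_combination (-(a0 : ℂ) + Complex.I * a1) * hcsc + ((s : ℂ) ^ 2 * a0 - s * c * a1) * (Complex.I_sq)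
    have r2 : b0 - Complex.I * b1 = (c - Complex.I * s) * ((c * b0 + s * b1) - Complex.I * (-s * b0 + c * b1)) := by
      linear_combination (-b0 + Complex.I * b1) * hcsc + ((s : ℂ) ^ 2 * b0 - s * c * b1) * (Complex.I_sq)
    have r3 : ((a1 : ℂ) * b1 - a0 * b0) + Complex.I * (a1 * b0 + a0 * b1) = -(((a0 : ℂ) - Complex.I * a1) * (b0 - Complex.I * b1)) := by
      linear_combination (a1 * b1) * Complex.I_sq
    rw [r3, r1, r2]; ring
  have n1 : ‖(c : ℂ) - Complex.I * s‖ = 1 := by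
    have : ‖(c : ℂ) - Complex.I * s‖ ^ 2 = 1 := by
      rw [Complex.sq_norm, Complex.normSq_apply]; simp; nlinarith
    nlinarith [norm_nonneg ((c : ℂ) - Complex.I * s)]
  have n2 : ‖(1 : ℂ) - Complex.I‖ = √2 := by
    rw [Complex.norm_def, Complex.normSq_apply]; norm_num
  rw [key, norm_neg, norm_mul, norm_mul, norm_mul, norm_pow, n1, n2, one_pow, one_mul, mul_assoc, ← mul_add]
  gcongr
  refine (norm_sub_le _ _).trans ?_
  rw [norm_mul, Complex.norm_I, one_mul]

lemma bil_bound {Φ : ℂ × ℂ → ℝ} (h : Bell Φ) (h0 : Φ 0 = 0) (F : Finset (ZLat 2)) (f g : ZLat 2 → ℂ) (M : ℝ) (hM : 0 < M)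
    (hS : ∀ r, 0 < r → ∀ x, ∃ c s : ℝ, c ^ 2 + s ^ 2 = 1 ∧ ‖form F f g r x‖ ≤ M * basisS F f g r x c s) :
    ‖∑ n ∈ F, g n * ∑ m ∈ F, BAker (n - m) * f m‖ ≤ M * ∑ m ∈ F, Φ (f m, g m) := by
  rw [bil_eq, norm_neg]
  have hΦ : 0 ≤ ∑ m ∈ F, Φ (f m, g m) := Finset.sum_nonneg fun m _ => h.nonneg _
  rw [← ENNReal.ofReal_le_ofReal_iff (by positivity), ofReal_norm]
  refine (enorm_integral_le_lintegral_enorm _).trans ?_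
  rw [lintegral_prod _ (form_int F f g).1.enorm]
  have e : ∀ r x, ‖form F f g r x‖ₑ = ENNReal.ofReal M * ENNReal.ofReal (M⁻¹ * ‖form F f g r x‖) := by
    intro r x
    rw [← ENNReal.ofReal_mul hM.le, mul_inv_cancel_left₀ hM.ne', ofReal_norm]
  simp_rw [e, lintegral_const_mul' _ _ ENNReal.ofReal_ne_top]
  rw [ENNReal.ofReal_mul hM.le]
  gcongr
  refine core h h0 F f g (fun r x => ENNReal.ofReal (M⁻¹ * ‖form F f g r x‖)) fun r hr x => ?_
  obtain ⟨c, s, hcs, hle⟩ := hS r hr x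
  refine ⟨c, s, hcs, ENNReal.ofReal_le_ofReal ?_⟩
  rwa [inv_mul_le_iff₀ hM]

lemma form_c (F : Finset (ZLat 2)) (f g : ZLat 2 → ℂ) (r : ℝ) (hr : 0 < r) (x : E2) :
    ∃ c s : ℝ, c ^ 2 + s ^ 2 = 1 ∧ ‖form F f g r x‖ ≤ 2 * basisS F f g r x c s := by
  obtain ⟨c, s, hcs, hle⟩ := pt_c (au 0 F f r x) (au 1 F f r x) (au 0 F g r x) (au 1 F g r x)
  refine ⟨c, s, hcs, ?_⟩
  have := (pHeatK_pos hr x).le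
  rw [basisS_eq F f g hr, form, norm_mul, Complex.norm_real, Real.norm_of_nonneg this, mul_left_comm]
  gcongr

lemma form_r (F : Finset (ZLat 2)) (f g : ZLat 2 → ℂ) (hf : ∀ n, (f n).im = 0) (r : ℝ) (hr : 0 < r) (x : E2) :
    ∃ c s : ℝ, c ^ 2 + s ^ 2 = 1 ∧ ‖form F f g r x‖ ≤ √2 * basisS F f g r x c s := by
  have e : ∀ j, au j F f r x = ((∑ m ∈ F, dd j m r x * (f m).re : ℝ) : ℂ) := by
    intro j
    unfold au
    push_cast
    refine Finset.sum_congr rfl fun m _ => ?_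
    congr 1
    apply Complex.ext <;> simp [hf]
  obtain ⟨c, s, hcs, hle⟩ := pt_r (∑ m ∈ F, dd 0 m r x * (f m).re) (∑ m ∈ F, dd 1 m r x * (f m).re) (au 0 F g r x) (au 1 F g r x)
  refine ⟨c, s, hcs, ?_⟩
  have := (pHeatK_pos hr x).le
  rw [basisS_eq F f g hr, form, norm_mul, Complex.norm_real, Real.norm_of_nonneg this, mul_left_comm]
  rw [← e, ← e] at hle
  gcongr

lemma tsum_le_nn {ι : Type*} (a : ι → ℝ) (c : ℝ) (hc : 0 ≤ c) (h : ∀ S : Finset ι, ∑ i ∈ S, a i ≤ c) : ∑' i, a i ≤ c := by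
  by_cases hs : Summable a
  · exact hs.tsum_le_of_sum_le h
  · rwa [tsum_eq_zero_of_not_summable hs]

lemma dual {p q : ℝ} (hpq : p.HolderConjugate q) (f : ZLat 2 → ℂ) (C : ℝ) (hC : 0 ≤ C)
    (hB : ∀ (F : Finset (ZLat 2)) (g : ZLat 2 → ℂ), ∑ n ∈ F, ‖g n‖ ^ q ≤ 1 →
      ‖∑ n ∈ F, g n * ∑ m ∈ F, BAker (n - m) * f m‖ ≤ C) :
    lpNC p (BAdis f) ≤ C := by
  have hp0 := hpq.pos
  have hq0 := hpq.symm.pos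
  have main : ∀ S : Finset (ZLat 2), ∑ n ∈ S, ‖BAdis f n‖ ^ p ≤ C ^ p := by
    intro S
    obtain ⟨⟨g, hg, hgeq⟩, -⟩ := NNReal.isGreatest_Lp S (fun n => ‖BAdis f n‖₊) hpq
    simp only [Set.mem_ofPred_eq] at hg hgeq
    classical
    let G : ZLat 2 → ℂ := fun n => if n ∈ S ∧ Summable (fun m => BAker (n - m) * f m) then
      ((starRingEnd ℂ) (BAdis f n) / ‖BAdis f n‖) * ((g n : ℝ) : ℂ) else 0
    have hG1 : ∀ n, ‖G n‖ ≤ if n ∈ S then (g n : ℝ) else 0 := by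
      intro n
      simp only [G]
      split_ifs with h1 h2 h2
      · rw [norm_mul, norm_div, RCLike.norm_conj, Complex.norm_real, Complex.norm_real, norm_norm]
        rw [Real.norm_of_nonneg (g n).coe_nonneg]
        exact mul_le_of_le_one_left (g n).coe_nonneg (div_self_le_one _)
      · exact absurd h1.1 h2
      · simp
      · simp
    have hG2 : ∀ n ∈ S, G n * BAdis f n = ((‖BAdis f n‖ * g n : ℝ) : ℂ) := by
      intro n hn
      by_cases hs : Summable (fun m => BAker (n - m) * f m)
      · simp only [G, hn, hs, and_self, if_true]
        by_cases h0 : BAdis f n = 0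
        · simp [h0]
        · have h1 : (‖BAdis f n‖ : ℂ) ≠ 0 := by simpa using h0
          have h2 : (starRingEnd ℂ) (BAdis f n) * BAdis f n = (‖BAdis f n‖ : ℂ) ^ 2 := Complex.conj_mul' _
          push_cast
          field_simp
          linear_combination ((g n : ℝ) : ℂ) * h2
      · have : BAdis f n = 0 := tsum_eq_zero_of_not_summable hs
        simp [this]
    have hlim : Tendsto (fun F : Finset (ZLat 2) => ∑ n ∈ S, G n * ∑ m ∈ F, BAker (n - m) * f m) atTop
        (nhds (∑ n ∈ S, G n * BAdis f n)) := by
      refine tendsto_finsetSum _ fun n hn => ?_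
      by_cases hs : Summable (fun m => BAker (n - m) * f m)
      · exact (hs.hasSum).const_mul (G n)
      · have : G n = 0 := by simp [G, hs]
        simp [this]
    have hle : ‖∑ n ∈ S, G n * BAdis f n‖ ≤ C := by
      refine le_of_tendsto hlim.norm ?_
      filter_upwards [eventually_ge_atTop S] with F hF
      have e : ∑ n ∈ S, G n * ∑ m ∈ F, BAker (n - m) * f m = ∑ n ∈ F, G n * ∑ m ∈ F, BAker (n - m) * f m := by
        refine Finset.sum_subset hF fun n _ hn => ?_
        simp [G, hn]
      rw [e]
      refine hB F G ?_
      calc ∑ n ∈ F, ‖G n‖ ^ q = ∑ n ∈ S, ‖G n‖ ^ q := by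
            refine (Finset.sum_subset hF fun n _ hn => ?_).symm
            simp [G, hn, hq0.ne']
        _ ≤ ∑ n ∈ S, (g n : ℝ) ^ q := by
            refine Finset.sum_le_sum fun n hn => ?_
            have := hG1 n
            rw [if_pos hn] at this
            gcongr
        _ ≤ 1 := by exact_mod_cast hg
    rw [Finset.sum_congr rfl hG2, ← Complex.ofReal_sum, Complex.norm_real] at hle
    have hle2 := (le_abs_self _).trans hle
    have e2 : (∑ n ∈ S, ‖BAdis f n‖ * g n : ℝ) = (∑ n ∈ S, ‖BAdis f n‖ ^ p) ^ (1 / p) := by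
      have := congrArg (fun r : NNReal => (r : ℝ)) hgeq
      push_cast at this
      exact this
    rw [e2] at hle2
    have h3 : 0 ≤ ∑ n ∈ S, ‖BAdis f n‖ ^ p := by positivity
    calc _ = ((∑ n ∈ S, ‖BAdis f n‖ ^ p) ^ (1 / p)) ^ p := by
          rw [← Real.rpow_mul h3, one_div_mul_cancel hp0.ne', Real.rpow_one]
      _ ≤ C ^ p := by gcongr
  have h1 := tsum_le_nn _ _ (by positivity) main
  unfold lpNC
  calc _ ≤ (C ^ p) ^ (1 / p) := by
        refine Real.rpow_le_rpow (tsum_nonneg fun n => by positivity) h1 (by positivity)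
    _ = C := by rw [← Real.rpow_mul hC, mul_one_div_cancel hp0.ne', Real.rpow_one]

lemma final {p : ℝ} (hp : 1 < p) (f : ZLat 2 → ℂ) (hf : MemLpLatC p f) (M : ℝ) (hM : 0 < M)
    (hS : ∀ (t : ℝ) F g r, 0 < r → ∀ x, ∃ c s : ℝ, c ^ 2 + s ^ 2 = 1 ∧
      ‖form F (fun m => (t : ℂ) * f m) g r x‖ ≤ M * basisS F (fun m => (t : ℂ) * f m) g r x c s) :
    lpNC p (BAdis f) ≤ M * (pstar p - 1) * lpNC p f := by
  have hpq := Real.HolderConjugate.conjExponent hp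
  set q := p.conjExponent
  obtain ⟨Φ, h, hb⟩ := bell_exists p q hpq
  have h0 : Φ 0 = 0 := by
    refine le_antisymm ?_ (h.nonneg _)
    have h1 : Φ 0 ≤ _ := hb 0 0
    refine h1.trans (le_of_eq ?_)
    simp [hpq.pos.ne', hpq.symm.pos.ne']
  have hps : 0 ≤ pstar p - 1 := by
    have : p ≤ pstar p := le_max_left _ _
    linarith
  have hp0 := hpq.pos
  have hq0 := hpq.symm.pos
  have hA : 0 ≤ ∑' n, ‖f n‖ ^ p := tsum_nonneg fun n => by positivity
  have hL : 0 ≤ lpNC p f := Real.rpow_nonneg hA _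
  have hLp : lpNC p f ^ p = ∑' n, ‖f n‖ ^ p := by
    unfold lpNC
    rw [← Real.rpow_mul hA, one_div_mul_cancel hp0.ne', Real.rpow_one]
  have step : ∀ N, lpNC p f < N → lpNC p (BAdis f) ≤ M * (pstar p - 1) * N := by
    intro N hN
    have hN0 : 0 < N := hL.trans_lt hN
    refine dual hpq f _ (by positivity) fun F g hg => ?_
    have hb1 := bil_bound h h0 F (fun m => ((N⁻¹ : ℝ) : ℂ) * f m) g M hM (hS N⁻¹ F g)
    have hf1 : ∑ m ∈ F, ‖((N⁻¹ : ℝ) : ℂ) * f m‖ ^ p ≤ 1 := by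
      have e : ∀ m, ‖((N⁻¹ : ℝ) : ℂ) * f m‖ ^ p = (N ^ p)⁻¹ * ‖f m‖ ^ p := by
        intro m
        rw [norm_mul, Complex.norm_real, Real.norm_of_nonneg (by positivity), Real.mul_rpow (by positivity) (by positivity),
          Real.inv_rpow hN0.le]
      simp_rw [e]
      rw [← Finset.mul_sum, inv_mul_le_iff₀ (by positivity), mul_one]
      calc _ ≤ ∑' m, ‖f m‖ ^ p := hf.sum_le_tsum F fun n _ => by positivity
        _ = lpNC p f ^ p := hLp.symm
        _ ≤ N ^ p := by gcongr
    have hsum : ∑ m ∈ F, Φ (((N⁻¹ : ℝ) : ℂ) * f m, g m) ≤ pstar p - 1 := by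
      calc _ ≤ ∑ m ∈ F, (pstar p - 1) * (‖((N⁻¹ : ℝ) : ℂ) * f m‖ ^ p / p + ‖g m‖ ^ q / q) :=
            Finset.sum_le_sum fun m _ => hb _ _
        _ = (pstar p - 1) * ((∑ m ∈ F, ‖((N⁻¹ : ℝ) : ℂ) * f m‖ ^ p) / p + (∑ m ∈ F, ‖g m‖ ^ q) / q) := by
            rw [← Finset.mul_sum, Finset.sum_add_distrib, Finset.sum_div, Finset.sum_div]
        _ ≤ (pstar p - 1) * (1 / p + 1 / q) := by gcongr
        _ = pstar p - 1 := by
            rw [one_div, one_div, hpq.inv_add_inv_eq_one, mul_one]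
    have e : ∑ n ∈ F, g n * ∑ m ∈ F, BAker (n - m) * (((N⁻¹ : ℝ) : ℂ) * f m) =
        ((N⁻¹ : ℝ) : ℂ) * ∑ n ∈ F, g n * ∑ m ∈ F, BAker (n - m) * f m := by
      simp only [Finset.mul_sum]
      refine Finset.sum_congr rfl fun n _ => Finset.sum_congr rfl fun m _ => ?_
      ring
    rw [e, norm_mul, Complex.norm_real, Real.norm_of_nonneg (by positivity), inv_mul_le_iff₀ hN0] at hb1
    refine hb1.trans ?_
    calc _ ≤ N * (M * (pstar p - 1)) := by gcongr
      _ = _ := by ring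
  have hlim : Tendsto (fun N => M * (pstar p - 1) * N) (nhdsWithin (lpNC p f) (Set.Ioi (lpNC p f)))
      (nhds (M * (pstar p - 1) * lpNC p f)) := by
    refine Tendsto.mono_left ?_ nhdsWithin_le_nhds
    exact (continuous_const.mul continuous_id).tendsto _
  exact ge_of_tendsto hlim (by filter_upwards [self_mem_nhdsWithin] with N hN using step N hN)

theorem stmt17 (p : ℝ) (hp : 1 < p) :
    (∀ f : ZLat 2 → ℂ, MemLpLatC p f →
      lpNC p (BAdis f) ≤ 2 * (pstar p - 1) * lpNC p f) ∧
    (∀ f : ZLat 2 → ℂ, MemLpLatC p f → (∀ n : ZLat 2, (f n).im = 0) →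
      lpNC p (BAdis f) ≤ Real.sqrt 2 * (pstar p - 1) * lpNC p f) := by
  refine ⟨fun f hf => final hp f hf 2 (by norm_num) fun t F g r hr x => form_c _ _ _ r hr x,
    fun f hf him => final hp f hf (√2) (by positivity) fun t F g r hr x => form_r _ _ _ ?_ r hr x⟩
  intro n
  simp [him]

end
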